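/- arXiv:2310.01131 — 6 statements merged into one kernel-verified Lean document; each statement's English description precedes it below -/
import Mathlib

section
/- For every integer n ≥ 2 there is a (well-defined) group homomorphism ι : B(B_n) → B(A_n) determined on generators by ι(σ_0) = σ_1² and ι(σ_i) = σ_{i+1} for 1 ≤ i ≤ n−1. -/
/-- The braid relator `σᵢσⱼσᵢσⱼ⁻¹σᵢ⁻¹σⱼ⁻¹` (imposing `σᵢσⱼσᵢ = σⱼσᵢσⱼ`). -/
def braidRelator {α : Type*} (i j : α) : FreeGroup α :=
  FreeGroup.of i * FreeGroup.of j * FreeGroup.of i *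
    (FreeGroup.of j)⁻¹ * (FreeGroup.of i)⁻¹ * (FreeGroup.of j)⁻¹

/-- The commutation relator `σᵢσⱼσᵢ⁻¹σⱼ⁻¹` (imposing `σᵢσⱼ = σⱼσᵢ`). -/
def commRelator {α : Type*} (i j : α) : FreeGroup α :=
  FreeGroup.of i * FreeGroup.of j * (FreeGroup.of i)⁻¹ * (FreeGroup.of j)⁻¹

/-- Relators of the braid group `B(Aₙ)` on `n+1` strands; the generator with index
`k : Fin n` is `σ_{k+1}`, so that the generators are `σ_1, …, σ_n`.  The relations are
`σᵢσ_{i+1}σᵢ = σ_{i+1}σᵢσ_{i+1}` (`1 ≤ i ≤ n-1`) and `σᵢσⱼ = σⱼσᵢ` (`|i-j| ≥ 2`). -/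
inductive BraidRelA (n : ℕ) : FreeGroup (Fin n) → Prop
  | braid (i j : Fin n) (h : (j : ℕ) = (i : ℕ) + 1) : BraidRelA n (braidRelator i j)
  | comm (i j : Fin n) (h : (i : ℕ) + 2 ≤ (j : ℕ)) : BraidRelA n (commRelator i j)

/-- Relators of the braid group `B(Bₙ)` of type `Bₙ`; the generator with index `k : Fin n` is
`σ_k`, so that the generators are `σ_0, σ_1, …, σ_{n-1}`.  The relations are
`σ₀σ₁σ₀σ₁ = σ₁σ₀σ₁σ₀`, `σᵢσ_{i+1}σᵢ = σ_{i+1}σᵢσ_{i+1}` (`1 ≤ i ≤ n-2`) and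
`σᵢσⱼ = σⱼσᵢ` (`|i-j| ≥ 2`). -/
inductive BraidRelB (n : ℕ) : FreeGroup (Fin n) → Prop
  | typeB (i j : Fin n) (hi : (i : ℕ) = 0) (hj : (j : ℕ) = 1) :
      BraidRelB n (FreeGroup.of i * FreeGroup.of j * FreeGroup.of i * FreeGroup.of j *
        (FreeGroup.of i)⁻¹ * (FreeGroup.of j)⁻¹ * (FreeGroup.of i)⁻¹ * (FreeGroup.of j)⁻¹)
  | braid (i j : Fin n) (hi : 1 ≤ (i : ℕ)) (h : (j : ℕ) = (i : ℕ) + 1) :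
      BraidRelB n (braidRelator i j)
  | comm (i j : Fin n) (h : (i : ℕ) + 2 ≤ (j : ℕ)) : BraidRelB n (commRelator i j)

/-- The braid group on `n+1` strands (type `Aₙ`); index `k : Fin n` is the generator
`σ_{k+1}`. -/
def BraidA (n : ℕ) : Type := PresentedGroup {w | BraidRelA n w}

instance (n : ℕ) : Group (BraidA n) := by unfold BraidA; infer_instance

/-- The braid group of type `Bₙ`; index `k : Fin n` is the generator `σ_k`. -/
def BraidB (n : ℕ) : Type := PresentedGroup {w | BraidRelB n w}

instance (n : ℕ) : Group (BraidB n) := by unfold BraidB; infer_instance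

/-- If `a` and `b` satisfy the braid relation, then `a²` and `b` satisfy the type `B₂` relation. -/
theorem sq_mul_mul_sq_mul_of_braid {G : Type*} [Group G] {a b : G} (h : a * b * a = b * a * b) :
    a ^ 2 * b * a ^ 2 * b = b * a ^ 2 * b * a ^ 2 :=
  calc a ^ 2 * b * a ^ 2 * b = a * (a * b * a) * (a * b) := by simp only [pow_two, mul_assoc]
    _ = a * (b * a * b) * (a * b) := by rw [h]
    _ = a * b * a * (b * a * b) := by simp only [mul_assoc]
    _ = b * a * b * (a * b * a) := by rw [h]
    _ = b * a * (b * a * b) * a := by simp only [mul_assoc]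
    _ = b * a ^ 2 * b * a ^ 2 := by rw [← h]; simp only [pow_two, mul_assoc]

namespace BraidA

/-- The generator of `BraidA n` with index `i`, that is, `σ_{i+1}`. -/
def gen {n : ℕ} (i : Fin n) : BraidA n :=
  (PresentedGroup.of i : PresentedGroup {w | BraidRelA n w})

theorem gen_braid {n : ℕ} {i j : Fin n} (h : (j : ℕ) = i + 1) :
    gen i * gen j * gen i = gen j * gen i * gen j := by
  have := PresentedGroup.one_of_mem (rels := {w | BraidRelA n w}) (BraidRelA.braid i j h)
  have h1 : gen i * gen j * gen i * (gen j)⁻¹ * (gen i)⁻¹ * (gen j)⁻¹ = 1 := this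
  simpa only [mul_inv_eq_iff_eq_mul, one_mul] using h1

theorem gen_comm {n : ℕ} {i j : Fin n} (h : (i : ℕ) + 2 ≤ j) : Commute (gen i) (gen j) := by
  have := PresentedGroup.one_of_mem (rels := {w | BraidRelA n w}) (BraidRelA.comm i j h)
  have h1 : gen i * gen j * (gen i)⁻¹ * (gen j)⁻¹ = 1 := this
  simpa only [commute_iff_eq, mul_inv_eq_iff_eq_mul, one_mul] using h1

/-- The images of the generators of `BraidB n`: `σ₀ ↦ σ₁²` and `σᵢ ↦ σ_{i+1}` for `1 ≤ i`. -/
def imageOfGenB {n : ℕ} (i : Fin n) : BraidA n :=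
  if (i : ℕ) = 0 then gen i ^ 2 else gen i

theorem lift_imageOfGenB_eq_one {n : ℕ} {w : FreeGroup (Fin n)} (hw : BraidRelB n w) :
    FreeGroup.lift imageOfGenB w = 1 := by
  cases hw with
  | typeB i j hi hj =>
    have hj0 : (j : ℕ) ≠ 0 := by omega
    simp only [map_mul, map_inv, FreeGroup.lift_apply_of, imageOfGenB, if_pos hi, if_neg hj0,
      mul_inv_eq_iff_eq_mul, one_mul]
    exact sq_mul_mul_sq_mul_of_braid (gen_braid (by omega))
  | braid i j hi h =>
    have hi0 : (i : ℕ) ≠ 0 := by omega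
    have hj0 : (j : ℕ) ≠ 0 := by omega
    simp only [braidRelator, map_mul, map_inv, FreeGroup.lift_apply_of, imageOfGenB, if_neg hi0,
      if_neg hj0, mul_inv_eq_iff_eq_mul, one_mul]
    exact gen_braid h
  | comm i j h =>
    have hj0 : (j : ℕ) ≠ 0 := by omega
    simp only [commRelator, map_mul, map_inv, FreeGroup.lift_apply_of, imageOfGenB, if_neg hj0,
      mul_inv_eq_iff_eq_mul, one_mul]
    split_ifs
    · exact (gen_comm h).pow_left 2
    · exact gen_comm h

end BraidA

/-- For every `n ≥ 2` there is a group homomorphism `ι : B(Bₙ) → B(Aₙ)` with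
`ι(σ₀) = σ₁²` and `ι(σᵢ) = σ_{i+1}` for `1 ≤ i ≤ n-1`.  (In the chosen indexings, the generator
`σ₀` of `B(Bₙ)` has index `0`, `σᵢ` has index `i`; the generator `σ_{k+1}` of `B(Aₙ)` has
index `k`, so `σ₁` has index `0` and `σ_{i+1}` has index `i`.) -/
theorem stmt_1 (n : ℕ) (hn : 2 ≤ n) :
    ∃ ι : BraidB n →* BraidA n,
      ι (PresentedGroup.of ⟨0, by omega⟩) = (PresentedGroup.of ⟨0, by omega⟩) ^ 2 ∧
      ∀ i : Fin n, 1 ≤ (i : ℕ) → ι (PresentedGroup.of i) = PresentedGroup.of i := by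
  have hw : ∀ w ∈ {w | BraidRelB n w}, FreeGroup.lift BraidA.imageOfGenB w = 1 :=
    fun _ h => BraidA.lift_imageOfGenB_eq_one h
  refine ⟨PresentedGroup.toGroup hw, ?_, fun i hi => ?_⟩
  · exact (PresentedGroup.toGroup.of hw).trans (if_pos rfl)
  · exact (PresentedGroup.toGroup.of hw).trans (if_neg (by omega))
end

section
/- For every integer n ≥ 1 there is an injective group homomorphism Ψ : W(B_n) → Equiv.Perm (Fin n × ZMod 2) with Ψ(s_0) equal to the transposition exchanging (0,0) and (0,1), and Ψ(s_i) equal to the product of the two disjoint transpositions exchanging (i−1,0) with (i,0) and (i−1,1) with (i,1), for 1 ≤ i ≤ n−1. The range of Ψ is exactly the subgroup of sign-preserving (signed) permutations, i.e. {σ ∈ Perm(Fin n × ZMod 2) : σ ∘ ν = ν ∘ σ}, where ν is the involution ν(j, ε) = (j, ε+1). -/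
/-- The Coxeter matrix of type `Bₙ`, with the `4`-bond between the generators `s₀` and `s₁`. -/
def BMat (n : ℕ) : CoxeterMatrix (Fin n) where
  M := Matrix.of fun i j : Fin n =>
    if i = j then 1
    else if (i : ℕ) = 0 ∧ (j : ℕ) = 1 ∨ (j : ℕ) = 0 ∧ (i : ℕ) = 1 then 4
    else if (j : ℕ) + 1 = i ∨ (i : ℕ) + 1 = j then 3
    else 2
  isSymm := by unfold Matrix.IsSymm; aesop
  diagonal := by simp
  off_diagonal := by aesop

/-- The sign-flip involution `ν(j, ε) = (j, ε + 1)` on `Fin n × ZMod 2`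
(encoding `{±1, …, ±n}` with negation). -/
def nu (n : ℕ) : Fin n × ZMod 2 → Fin n × ZMod 2 := fun p => (p.1, p.2 + 1)

section Words

variable {G : Type*} [Group G]

/-- The relations of type `B` for the first `n` terms of a sequence of group elements. -/
structure IsTypeB (s : ℕ → G) (n : ℕ) : Prop where
  mul_self : ∀ i, i < n → s i * s i = 1
  comm : ∀ i j, i + 2 ≤ j → j < n → s i * s j = s j * s i
  braid : ∀ i, i + 2 < n → s (i + 1) * s (i + 2) * s (i + 1) = s (i + 2) * s (i + 1) * s (i + 2)
  braid_zero : 1 < n → s 0 * s 1 * s 0 * s 1 = s 1 * s 0 * s 1 * s 0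

/-- The product `s (j + 1) * s (j + 2) * ⋯ * s (j + m)`. -/
def ascWord (s : ℕ → G) : ℕ → ℕ → G
  | _, 0 => 1
  | j, m + 1 => s (j + 1) * ascWord s (j + 1) m

/-- The product `s j * s (j - 1) * ⋯ * s 0`. -/
def descWord (s : ℕ → G) : ℕ → G
  | 0 => s 0
  | j + 1 => s (j + 1) * descWord s j

/-- The subgroup generated by `s 0, …, s (k - 1)`. -/
def parabolic (s : ℕ → G) (k : ℕ) : Subgroup G := Subgroup.closure (s '' Set.Iio k)

theorem mem_parabolic (s : ℕ → G) {i k : ℕ} (h : i < k) : s i ∈ parabolic s k :=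
  Subgroup.subset_closure ⟨i, h, rfl⟩

theorem ascWord_mem_parabolic (s : ℕ → G) (j m : ℕ) {k : ℕ} (h : j + m < k) :
    ascWord s j m ∈ parabolic s k := by
  induction m generalizing j with
  | zero => exact one_mem _
  | succ m ih => exact mul_mem (mem_parabolic s (by omega)) (ih _ (by omega))

theorem descWord_mem_parabolic (s : ℕ → G) (j : ℕ) {k : ℕ} (h : j < k) :
    descWord s j ∈ parabolic s k := by
  induction j with
  | zero => exact mem_parabolic s h
  | succ j ih => exact mul_mem (mem_parabolic s h) (ih (by omega))

namespace IsTypeB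

variable {s : ℕ → G} {n : ℕ}

theorem mul_ascWord_of_lt (hs : IsTypeB s n) {i j m : ℕ} (hij : i < j) (hn : j + m < n) :
    s i * ascWord s j m = ascWord s j m * s i := by
  induction m generalizing j with
  | zero => simp [ascWord]
  | succ m ih =>
    rw [ascWord, ← mul_assoc, hs.comm i (j + 1) (by omega) (by omega), mul_assoc,
      ih (by omega) (by omega), mul_assoc]

theorem mul_ascWord_of_le (hs : IsTypeB s n) {j l m : ℕ} (hlm : l + 2 ≤ m) (hn : j + m < n) :
    s (j + l + 2) * ascWord s j m = ascWord s j m * s (j + l + 1) := by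
  induction l generalizing j m with
  | zero =>
    obtain ⟨m, rfl⟩ : ∃ m', m = m' + 2 := ⟨m - 2, by omega⟩
    simp only [ascWord, add_zero, add_assoc, Nat.reduceAdd]
    rw [← mul_assoc, ← mul_assoc, ← hs.braid j (by omega), mul_assoc,
      hs.mul_ascWord_of_lt (by omega) (by omega)]
    simp only [mul_assoc]
  | succ l ih =>
    obtain ⟨m, rfl⟩ : ∃ m', m = m' + 1 := ⟨m - 1, by omega⟩
    have := ih (j := j + 1) (m := m) (by omega) (by omega)
    rw [show j + 1 + l + 2 = j + (l + 1) + 2 by omega,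
      show j + 1 + l + 1 = j + (l + 1) + 1 by omega] at this
    rw [ascWord, ← mul_assoc, ← hs.comm (j + 1) _ (by omega) (by omega), mul_assoc, this, mul_assoc]

theorem mul_descWord_of_lt (hs : IsTypeB s n) {i j : ℕ} (hij : j + 2 ≤ i) (hn : i < n) :
    s i * descWord s j = descWord s j * s i := by
  induction j with
  | zero => exact (hs.comm 0 i hij hn).symm
  | succ j ih =>
    rw [descWord, ← mul_assoc, ← hs.comm (j + 1) i (by omega) hn, mul_assoc, ih (by omega),
      mul_assoc]

theorem mul_descWord_of_le (hs : IsTypeB s n) {i j : ℕ} (hij : i + 2 ≤ j) (hn : j < n) :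
    s (i + 1) * descWord s j = descWord s j * s (i + 2) := by
  induction j, hij using Nat.le_induction with
  | base =>
    rw [descWord, descWord, ← mul_assoc, ← mul_assoc, hs.braid i hn, mul_assoc,
      hs.mul_descWord_of_lt (by omega) hn]
    simp only [mul_assoc]
  | succ j hij ih =>
    rw [descWord, ← mul_assoc, hs.comm (i + 1) (j + 1) (by omega) hn, mul_assoc, ih (by omega),
      mul_assoc]

theorem zero_mul_descWord_mul_ascWord (hs : IsTypeB s n) {j k : ℕ} (hj : 1 ≤ j) (hjk : j ≤ k)
    (hn : k < n) :
    s 0 * (descWord s j * ascWord s 0 k) = descWord s j * ascWord s 0 k * s 0 := by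
  induction j, hj using Nat.le_induction with
  | base =>
    obtain ⟨k, rfl⟩ : ∃ k', k = k' + 1 := ⟨k - 1, by omega⟩
    have h := hs.braid_zero (by omega)
    have h' := hs.mul_ascWord_of_lt (i := 0) (j := 1) (m := k) (by omega) (by omega)
    simp only [descWord, ascWord, zero_add, mul_assoc] at h ⊢
    rw [← h']
    simp only [← mul_assoc] at h ⊢
    rw [h]
  | succ j hj ih =>
    rw [descWord, mul_assoc, ← mul_assoc, hs.comm 0 (j + 1) (by omega) (by omega), mul_assoc,
      ih (by omega)]
    simp only [mul_assoc]

/-- The left cosets of `parabolic s k` in `parabolic s (k + 1)` are represented by the words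
`ascWord s j (k - j)` and `descWord s j * ascWord s 0 k` with `j ≤ k`. -/
theorem exists_coset_rep (hs : IsTypeB s n) {k : ℕ} (hk : k < n) {g : G}
    (hg : g ∈ parabolic s (k + 1)) :
    ∃ u ∈ parabolic s k, (∃ j m, j + m = k ∧ g = ascWord s j m * u) ∨
      ∃ j ≤ k, g = descWord s j * ascWord s 0 k * u := by
  have key : ∀ i, i < k + 1 → ∀ y,
      (∃ u ∈ parabolic s k, (∃ j m, j + m = k ∧ y = ascWord s j m * u) ∨
        ∃ j ≤ k, y = descWord s j * ascWord s 0 k * u) →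
      ∃ u ∈ parabolic s k, (∃ j m, j + m = k ∧ s i * y = ascWord s j m * u) ∨
      ∃ j ≤ k, s i * y = descWord s j * ascWord s 0 k * u := by
    rintro i hi y ⟨u, hu, ⟨j, m, rfl, rfl⟩ | ⟨j, hj, rfl⟩⟩
    · rcases lt_trichotomy i j with h | rfl | h
      · refine ⟨s i * u, mul_mem (mem_parabolic s (by omega)) hu, .inl ⟨j, m, rfl, ?_⟩⟩
        rw [← mul_assoc, hs.mul_ascWord_of_lt h hk, mul_assoc]
      · refine ⟨u, hu, ?_⟩
        cases i with
        | zero => exact .inr ⟨0, by omega, by simp [descWord, mul_assoc]⟩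
        | succ i => exact .inl ⟨i, m + 1, by omega, by simp [ascWord, mul_assoc]⟩
      · obtain ⟨m, rfl⟩ : ∃ m', m = m' + 1 := ⟨m - 1, by omega⟩
        obtain rfl | h := eq_or_lt_of_le (Nat.succ_le_of_lt h)
        · refine ⟨u, hu, .inl ⟨j + 1, m, by omega, ?_⟩⟩
          rw [ascWord, ← mul_assoc, ← mul_assoc, hs.mul_self _ (by omega), one_mul]
        · obtain ⟨l, rfl⟩ : ∃ l, i = j + l + 2 := ⟨i - j - 2, by omega⟩
          refine ⟨s (j + l + 1) * u, mul_mem (mem_parabolic s (by omega)) hu,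
            .inl ⟨j, m + 1, rfl, ?_⟩⟩
          rw [← mul_assoc, hs.mul_ascWord_of_le (by omega) hk, mul_assoc]
    · rcases lt_trichotomy i j with h | rfl | h
      · refine ⟨s i * u, mul_mem (mem_parabolic s (by omega)) hu, .inr ⟨j, hj, ?_⟩⟩
        rw [← mul_assoc, ← mul_assoc _ (s i)]
        congr 1
        cases i with
        | zero => exact hs.zero_mul_descWord_mul_ascWord h hj hk
        | succ i =>
          have := hs.mul_ascWord_of_le (j := 0) (l := i) (m := k) (by omega) (by omega)
          rw [← mul_assoc, hs.mul_descWord_of_le h (by omega), mul_assoc, mul_assoc]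
          simpa using this
      · refine ⟨u, hu, ?_⟩
        cases i with
        | zero =>
          refine .inl ⟨0, k, by omega, ?_⟩
          rw [descWord, ← mul_assoc, ← mul_assoc, hs.mul_self _ (by omega), one_mul]
        | succ i =>
          refine .inr ⟨i, by omega, ?_⟩
          rw [descWord]
          simp only [← mul_assoc]
          rw [hs.mul_self _ (by omega), one_mul]
      · obtain rfl | h := eq_or_lt_of_le (Nat.succ_le_of_lt h)
        · exact ⟨u, hu, .inr ⟨j + 1, by omega, by simp [descWord, mul_assoc]⟩⟩
        · obtain ⟨l, rfl⟩ : ∃ l, i = l + 2 := ⟨i - 2, by omega⟩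
          refine ⟨s (l + 1) * u, mul_mem (mem_parabolic s (by omega)) hu, .inr ⟨j, hj, ?_⟩⟩
          have := hs.mul_ascWord_of_le (j := 0) (l := l) (m := k) (by omega) (by omega)
          rw [zero_add] at this
          rw [← mul_assoc, ← mul_assoc (s _), hs.mul_descWord_of_lt h (by omega),
            mul_assoc (descWord s j), this]
          simp only [mul_assoc]
  induction hg using Subgroup.closure_induction_left with
  | one => exact ⟨1, one_mem _, .inl ⟨k, 0, rfl, by simp [ascWord]⟩⟩
  | mul_left x hx y _ ih =>
    obtain ⟨i, hi, rfl⟩ := hx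
    exact key i hi y ih
  | inv_mul_cancel x hx y _ ih =>
    obtain ⟨i, hi, rfl⟩ := hx
    rw [inv_eq_of_mul_eq_one_left (hs.mul_self i (by simp at hi; omega))]
    exact key i hi y ih

end IsTypeB

end Words

section SignedPerm

variable {n : ℕ}

/-- The signed permutations attached to the simple generators of type `B`. -/
def signedGen (i : Fin n) : Equiv.Perm (Fin n × ZMod 2) :=
  if (i : ℕ) = 0 then Equiv.swap (i, 0) (i, 1)
  else Equiv.swap (⟨(i : ℕ) - 1, lt_of_le_of_lt (Nat.sub_le _ _) i.isLt⟩, 0) (i, 0) *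
    Equiv.swap (⟨(i : ℕ) - 1, lt_of_le_of_lt (Nat.sub_le _ _) i.isLt⟩, 1) (i, 1)

theorem zmod_two_cases (e : ZMod 2) : e = 0 ∨ e = 1 := by
  revert e; decide

theorem signedGen_apply_fst (i : Fin n) (x : Fin n × ZMod 2) :
    ((signedGen i x).1 : ℕ) = if (i : ℕ) = 0 then (x.1 : ℕ) else
      if (x.1 : ℕ) = i then (i : ℕ) - 1 else if (x.1 : ℕ) + 1 = i then (i : ℕ) else x.1 := by
  obtain ⟨⟨j, hj⟩, e⟩ := x
  obtain ⟨i, hi⟩ := i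
  have : (0 : ZMod 2) ≠ 1 := by decide
  obtain rfl | rfl := zmod_two_cases e <;>
    simp only [signedGen] <;> split_ifs <;>
    simp only [Equiv.Perm.mul_apply, Equiv.swap_apply_def, Prod.mk.injEq, Fin.mk.injEq] <;> grind

theorem signedGen_apply_snd (i : Fin n) (x : Fin n × ZMod 2) :
    (signedGen i x).2 = if (i : ℕ) = 0 ∧ (x.1 : ℕ) = 0 then x.2 + 1 else x.2 := by
  obtain ⟨⟨j, hj⟩, e⟩ := x
  obtain ⟨i, hi⟩ := i
  have : (0 : ZMod 2) ≠ 1 := by decide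
  have : (1 + 1 : ZMod 2) = 0 := by decide
  obtain rfl | rfl := zmod_two_cases e <;>
    simp only [signedGen] <;> split_ifs <;>
    simp only [Equiv.Perm.mul_apply, Equiv.swap_apply_def, Prod.mk.injEq, Fin.mk.injEq] <;> grind

theorem signedPerm_ext {σ τ : Equiv.Perm (Fin n × ZMod 2)}
    (h₁ : ∀ x, ((σ x).1 : ℕ) = (τ x).1) (h₂ : ∀ x, (σ x).2 = (τ x).2) : σ = τ :=
  Equiv.ext fun x => Prod.ext (Fin.ext (h₁ x)) (h₂ x)

theorem isLiftable_signedGen : (BMat n).IsLiftable (signedGen (n := n)) := by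
  intro i j
  have h2 : ∀ e : ZMod 2, e + 1 + 1 = e := by decide
  simp only [BMat, Matrix.of_apply, Fin.ext_iff]
  split_ifs with h h h
  all_goals
    apply signedPerm_ext <;> intro x <;>
    simp only [pow_succ, pow_zero, one_mul, Equiv.Perm.mul_apply, signedGen_apply_fst,
      signedGen_apply_snd, Equiv.Perm.one_apply] <;> grind

theorem signedGen_nu (i : Fin n) (x : Fin n × ZMod 2) :
    signedGen i (nu n x) = nu n (signedGen i x) := by
  apply Prod.ext
  · apply Fin.ext
    simp only [nu, signedGen_apply_fst]
  · simp only [nu, signedGen_apply_snd]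
    split_ifs <;> rfl

variable (n) in
/-- The simple reflections of type `B` as a sequence, with value `1` beyond the rank. -/
def simpleSeq (i : ℕ) : (BMat n).Group := if h : i < n then (BMat n).simple ⟨i, h⟩ else 1

theorem simpleSeq_of_lt {i : ℕ} (h : i < n) : simpleSeq n i = (BMat n).simple ⟨i, h⟩ := dif_pos h

theorem isTypeB_simpleSeq : IsTypeB (simpleSeq n) n := by
  have hsq : ∀ i : Fin n, (BMat n).simple i * (BMat n).simple i = 1 :=
    (BMat n).toCoxeterSystem.simple_mul_simple_self
  have hinv : ∀ i : Fin n, ((BMat n).simple i)⁻¹ = (BMat n).simple i :=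
    (BMat n).toCoxeterSystem.inv_simple
  have hpow : ∀ i j : Fin n, ((BMat n).simple i * (BMat n).simple j) ^ (BMat n).M i j = 1 :=
    (BMat n).toCoxeterSystem.simple_mul_simple_pow
  refine ⟨fun i hi => ?_, fun i j hij hj => ?_, fun i hi => ?_, fun hn => ?_⟩
  · rw [simpleSeq_of_lt hi, hsq]
  · rw [simpleSeq_of_lt hj, simpleSeq_of_lt (show i < n by omega)]
    have h := hpow ⟨i, by omega⟩ ⟨j, hj⟩
    rw [show (BMat n).M ⟨i, by omega⟩ ⟨j, hj⟩ = 2 by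
      simp only [BMat, Matrix.of_apply, Fin.mk.injEq]; grind, pow_two] at h
    simpa [hinv] using eq_inv_of_mul_eq_one_left h
  · rw [simpleSeq_of_lt hi, simpleSeq_of_lt (show i + 1 < n by omega)]
    have h := hpow ⟨i + 1, by omega⟩ ⟨i + 2, hi⟩
    rw [show (BMat n).M ⟨i + 1, by omega⟩ ⟨i + 2, hi⟩ = 3 by
      simp only [BMat, Matrix.of_apply, Fin.mk.injEq]; grind] at h
    simp only [pow_succ, pow_zero, one_mul, ← mul_assoc] at h
    rw [mul_assoc _ _ (CoxeterMatrix.simple _ _), mul_assoc _ (CoxeterMatrix.simple _ _)] at h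
    simpa [hinv, mul_assoc] using eq_inv_of_mul_eq_one_left h
  · rw [simpleSeq_of_lt hn, simpleSeq_of_lt (show 0 < n by omega)]
    have h := hpow ⟨0, by omega⟩ ⟨1, hn⟩
    rw [show (BMat n).M ⟨0, by omega⟩ ⟨1, hn⟩ = 4 by
      simp [BMat], show 4 = 2 + 2 from rfl, pow_add] at h
    simpa [hinv, pow_two, mul_assoc] using eq_inv_of_mul_eq_one_left h

theorem parabolic_simpleSeq : parabolic (simpleSeq n) n = ⊤ := by
  rw [eq_top_iff, ← (BMat n).toCoxeterSystem.subgroup_closure_range_simple, Subgroup.closure_le]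
  rintro _ ⟨i, rfl⟩
  have := mem_parabolic (simpleSeq n) i.isLt
  rwa [simpleSeq_of_lt i.isLt] at this

variable (n) in
/-- The action of the Coxeter group of type `B` by signed permutations. -/
def signedRep : (BMat n).Group →* Equiv.Perm (Fin n × ZMod 2) :=
  (BMat n).toCoxeterSystem.lift ⟨signedGen, isLiftable_signedGen⟩

theorem signedRep_simple (i : Fin n) : signedRep n ((BMat n).simple i) = signedGen i :=
  (BMat n).toCoxeterSystem.lift_apply_simple isLiftable_signedGen i

theorem signedRep_simpleSeq {i : ℕ} (h : i < n) :
    signedRep n (simpleSeq n i) = signedGen ⟨i, h⟩ := by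
  rw [simpleSeq_of_lt h, signedRep_simple]

theorem signedRep_nu (w : (BMat n).Group) (x : Fin n × ZMod 2) :
    signedRep n w (nu n x) = nu n (signedRep n w x) := by
  induction w using (BMat n).toCoxeterSystem.simple_induction generalizing x with
  | simple i => exact (signedRep_simple i).symm ▸ signedGen_nu i x
  | one => simp
  | mul w w' ih ih' => rw [map_mul, Equiv.Perm.mul_apply, Equiv.Perm.mul_apply, ih', ih]

theorem signedRep_ascWord_apply {j m : ℕ} (h : j + m < n) (e : ZMod 2) :
    signedRep n (ascWord (simpleSeq n) j m) (⟨j + m, h⟩, e) = (⟨j, by omega⟩, e) := by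
  induction m generalizing j with
  | zero => simp [ascWord]
  | succ m ih =>
    have := ih (j := j + 1) (by omega)
    simp only [show j + 1 + m = j + (m + 1) by omega] at this
    rw [ascWord, map_mul, Equiv.Perm.mul_apply, this, signedRep_simpleSeq (by omega)]
    refine Prod.ext (Fin.ext ?_) ?_
    · simp [signedGen_apply_fst]
    · simp [signedGen_apply_snd]

theorem signedRep_descWord_apply {j : ℕ} (h : j < n) (e : ZMod 2) :
    signedRep n (descWord (simpleSeq n) j) (⟨0, by omega⟩, e) = (⟨j, h⟩, e + 1) := by
  induction j with
  | zero =>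
    rw [descWord, signedRep_simpleSeq h]
    refine Prod.ext (Fin.ext ?_) ?_
    · simp [signedGen_apply_fst]
    · simp [signedGen_apply_snd]
  | succ j ih =>
    rw [descWord, map_mul, Equiv.Perm.mul_apply, ih (by omega), signedRep_simpleSeq h]
    refine Prod.ext (Fin.ext ?_) ?_
    · simp [signedGen_apply_fst]
    · simp [signedGen_apply_snd]

theorem signedRep_descWord_mul_ascWord_apply {j k : ℕ} (hj : j < n) (hk : k < n) (e : ZMod 2) :
    signedRep n (descWord (simpleSeq n) j * ascWord (simpleSeq n) 0 k) (⟨k, hk⟩, e) =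
      (⟨j, hj⟩, e + 1) := by
  have := signedRep_ascWord_apply (n := n) (j := 0) (m := k) (by omega) e
  simp only [zero_add] at this
  rw [map_mul, Equiv.Perm.mul_apply, this, signedRep_descWord_apply hj]

theorem signedRep_apply_of_mem_parabolic {k : ℕ} (hk : k ≤ n) {u : (BMat n).Group}
    (hu : u ∈ parabolic (simpleSeq n) k) {x : Fin n × ZMod 2} (hx : k ≤ x.1) :
    signedRep n u x = x := by
  have : parabolic (simpleSeq n) k ≤
      (MulAction.stabilizer (Equiv.Perm (Fin n × ZMod 2)) x).comap (signedRep n) := by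
    refine (Subgroup.closure_le _).2 ?_
    rintro _ ⟨i, hi : i < k, rfl⟩
    simp only [SetLike.mem_coe, Subgroup.mem_comap, MulAction.mem_stabilizer_iff,
      Equiv.Perm.smul_def, signedRep_simpleSeq (lt_of_lt_of_le hi hk)]
    refine Prod.ext (Fin.ext ?_) ?_
    · rw [signedGen_apply_fst]; grind
    · rw [signedGen_apply_snd]; grind
  exact this hu

theorem eq_one_of_mem_parabolic {k : ℕ} (hk : k ≤ n) {w : (BMat n).Group}
    (hw : w ∈ parabolic (simpleSeq n) k) (h : signedRep n w = 1) : w = 1 := by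
  induction k generalizing w with
  | zero => simpa [parabolic] using hw
  | succ k ih =>
    obtain ⟨u, hu, ⟨j, m, rfl, rfl⟩ | ⟨j, hj, rfl⟩⟩ :=
      isTypeB_simpleSeq.exists_coset_rep (by omega) hw
    · have hx := congrArg (· (⟨j + m, hk⟩, (0 : ZMod 2))) h
      simp only [map_mul, Equiv.Perm.mul_apply, Equiv.Perm.one_apply] at hx
      rw [signedRep_apply_of_mem_parabolic (by omega) hu le_rfl, signedRep_ascWord_apply] at hx
      obtain rfl : m = 0 := by simpa using hx
      rw [ascWord, one_mul] at h ⊢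
      exact ih (by omega) hu h
    · have hx := congrArg (· (⟨k, hk⟩, (0 : ZMod 2))) h
      simp only [map_mul _ _ u, Equiv.Perm.mul_apply, Equiv.Perm.one_apply] at hx
      rw [signedRep_apply_of_mem_parabolic (by omega) hu le_rfl,
        signedRep_descWord_mul_ascWord_apply (by omega)] at hx
      simp at hx

theorem signedRep_injective : Function.Injective (signedRep n) :=
  (injective_iff_map_eq_one _).2 fun w hw =>
    eq_one_of_mem_parabolic le_rfl (parabolic_simpleSeq (n := n) ▸ Subgroup.mem_top w) hw

theorem exists_mem_parabolic_apply_eq {k : ℕ} (hk : k < n) {p : Fin n × ZMod 2}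
    (hp : (p.1 : ℕ) ≤ k) :
    ∃ t ∈ parabolic (simpleSeq n) (k + 1), signedRep n t (⟨k, hk⟩, 0) = p := by
  obtain ⟨⟨j, hj⟩, e⟩ := p
  obtain rfl | rfl := zmod_two_cases e
  · obtain ⟨m, rfl⟩ : ∃ m, k = j + m := ⟨k - j, by simp at hp; omega⟩
    exact ⟨_, ascWord_mem_parabolic _ j m (Nat.lt_succ_self _), signedRep_ascWord_apply hk 0⟩
  · refine ⟨_, mul_mem (descWord_mem_parabolic _ j (Nat.lt_succ_of_le hp))
      (ascWord_mem_parabolic _ 0 k (by omega)), ?_⟩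
    rw [signedRep_descWord_mul_ascWord_apply hj hk, zero_add]

theorem mem_range_of_apply_eq {k : ℕ} (hk : k ≤ n) {σ : Equiv.Perm (Fin n × ZMod 2)}
    (hσ : ∀ x, σ (nu n x) = nu n (σ x)) (hfix : ∀ x : Fin n × ZMod 2, k ≤ x.1 → σ x = x) :
    σ ∈ (signedRep n).range := by
  induction k generalizing σ with
  | zero =>
    obtain rfl : σ = 1 := Equiv.ext fun x => hfix x (Nat.zero_le _)
    exact one_mem _
  | succ k ih =>
    have hp : ((σ (⟨k, hk⟩, 0)).1 : ℕ) ≤ k := by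
      by_contra! hlt
      have := congrArg (fun x => (x.1 : ℕ)) (σ.injective (hfix _ hlt))
      simp only at this
      omega
    obtain ⟨t, ht, htp⟩ := exists_mem_parabolic_apply_eq hk hp
    have hcomm : ∀ x, (signedRep n t⁻¹ * σ) (nu n x) = nu n ((signedRep n t⁻¹ * σ) x) := fun x => by
      rw [Equiv.Perm.mul_apply, Equiv.Perm.mul_apply, hσ, signedRep_nu]
    have hk0 : (signedRep n t⁻¹ * σ) (⟨k, hk⟩, 0) = (⟨k, hk⟩, 0) := by
      rw [Equiv.Perm.mul_apply, ← htp, ← Equiv.Perm.mul_apply, ← map_mul, inv_mul_cancel, map_one,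
        Equiv.Perm.one_apply]
    have hmem := ih (σ := signedRep n t⁻¹ * σ) (by omega) hcomm fun x hx => by
      obtain hx | hx := eq_or_lt_of_le hx
      · obtain ⟨⟨_, _⟩, e⟩ := x
        obtain rfl := hx
        obtain rfl | rfl := zmod_two_cases e
        · exact hk0
        · have := hcomm (⟨k, hk⟩, 0)
          rw [hk0] at this
          simpa [nu] using this
      · rw [Equiv.Perm.mul_apply, hfix x hx,
          signedRep_apply_of_mem_parabolic hk (inv_mem ht) hx]
    simpa using mul_mem (MonoidHom.mem_range.2 ⟨t, rfl⟩) hmem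

theorem coe_range_signedRep :
    ((signedRep n).range : Set (Equiv.Perm (Fin n × ZMod 2))) =
      {σ : Equiv.Perm (Fin n × ZMod 2) | ⇑σ ∘ nu n = nu n ∘ ⇑σ} := by
  ext σ
  constructor
  · rintro ⟨w, rfl⟩
    exact funext (signedRep_nu w)
  · intro hσ
    exact mem_range_of_apply_eq le_rfl (congrFun hσ) fun x hx => absurd x.1.isLt (by omega)

end SignedPerm

/-- For every `n ≥ 1` there is an injective group homomorphism
`Ψ : W(Bₙ) → Perm (Fin n × ZMod 2)` with `Ψ(s₀)` the transposition of `(0,0)` and `(0,1)` and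
`Ψ(sᵢ)` the product of the transpositions `((i-1,0) (i,0))` and `((i-1,1) (i,1))` for
`1 ≤ i ≤ n-1`, whose range is exactly the subgroup of sign-preserving permutations. -/
theorem stmt_3 (n : ℕ) (hn : 1 ≤ n) :
    ∃ Ψ : (BMat n).Group →* Equiv.Perm (Fin n × ZMod 2),
      Function.Injective Ψ ∧
      Ψ ((BMat n).simple ⟨0, by omega⟩) =
        Equiv.swap (⟨0, by omega⟩, (0 : ZMod 2)) (⟨0, by omega⟩, (1 : ZMod 2)) ∧
      (∀ i : Fin n, 1 ≤ (i : ℕ) →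
        Ψ ((BMat n).simple i) =
          Equiv.swap (⟨(i : ℕ) - 1, lt_of_le_of_lt (Nat.sub_le _ _) i.isLt⟩, (0 : ZMod 2))
              (i, (0 : ZMod 2)) *
            Equiv.swap (⟨(i : ℕ) - 1, lt_of_le_of_lt (Nat.sub_le _ _) i.isLt⟩, (1 : ZMod 2))
              (i, (1 : ZMod 2))) ∧
      (Ψ.range : Set (Equiv.Perm (Fin n × ZMod 2))) =
        {σ : Equiv.Perm (Fin n × ZMod 2) | ⇑σ ∘ nu n = nu n ∘ ⇑σ} := by
  refine ⟨signedRep n, signedRep_injective, ?_, fun i hi => ?_, coe_range_signedRep⟩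
  · rw [signedRep_simple, signedGen, if_pos rfl]
  · rw [signedRep_simple, signedGen, if_neg (by omega)]
end

section
/- For every integer n ≥ 1, the number of conjugacy classes of W(B_n) equals the number of bipartitions of n; that is, Nat.card (ConjClasses W(B_n)) = Σ_{k=0}^{n} p(k)·p(n−k), where p(j) denotes the number of partitions of j. -/
/-- The defining relations of type `B` among the elements `s 0, …, s m` of a group. -/
structure BRelations {G : Type*} [Group G] (m : ℕ) (s : ℕ → G) : Prop where
  sq : ∀ j ≤ m, s j * s j = 1
  comm : ∀ i j, i + 1 < j → j ≤ m → s i * s j = s j * s i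
  braid : ∀ i, 1 ≤ i → i + 1 ≤ m → s i * s (i + 1) * s i = s (i + 1) * s i * s (i + 1)
  braid_four : 1 ≤ m → s 0 * s 1 * s 0 * s 1 = s 1 * s 0 * s 1 * s 0

/-- The product `s a * s (a + 1) * ⋯ * s m`. -/
def ascProd {G : Type*} [Group G] (m : ℕ) (s : ℕ → G) (a : ℕ) : G :=
  ((List.Ico a (m + 1)).map s).prod

/-- The product `s t * ⋯ * s 1 * s 0 * s 1 * ⋯ * s m`. -/
def foldProd {G : Type*} [Group G] (m : ℕ) (s : ℕ → G) : ℕ → G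
  | 0 => ascProd m s 0
  | t + 1 => s (t + 1) * foldProd m s t

namespace BRelations

variable {G : Type*} [Group G] {m : ℕ} {s : ℕ → G}

theorem ascProd_of_le {a : ℕ} (ha : a ≤ m) : ascProd m s a = s a * ascProd m s (a + 1) := by
  simp [ascProd, List.Ico.eq_cons (show a < m + 1 by omega)]

theorem ascProd_top : ascProd m s (m + 1) = 1 := by
  simp [ascProd]

theorem mul_ascProd_of_lt (h : BRelations m s) {j a : ℕ} (hj : j + 1 < a) (ha : a ≤ m + 1) :
    s j * ascProd m s a = ascProd m s a * s j := by
  induction ha using Nat.decreasingInduction with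
  | self => simp [ascProd_top]
  | of_succ k hk ih =>
    rw [ascProd_of_le (by omega), ← mul_assoc, h.comm j k hj (by omega), mul_assoc,
      ih (by omega), mul_assoc]

theorem mul_ascProd_of_le (h : BRelations m s) {i a : ℕ} (hi : 1 ≤ i) (him : i + 1 ≤ m)
    (ha : a ≤ i) : s (i + 1) * ascProd m s a = ascProd m s a * s i := by
  induction ha using Nat.decreasingInduction with
  | self =>
    rw [ascProd_of_le (by omega), ascProd_of_le him]
    calc s (i + 1) * (s i * (s (i + 1) * ascProd m s (i + 1 + 1)))
        = s (i + 1) * s i * s (i + 1) * ascProd m s (i + 1 + 1) := by group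
      _ = s i * s (i + 1) * (s i * ascProd m s (i + 1 + 1)) := by
        rw [← h.braid i hi him]; group
      _ = _ := by rw [h.mul_ascProd_of_lt (by omega) (by omega)]; group
  | of_succ k hk ih =>
    rw [ascProd_of_le (by omega), ← mul_assoc, ← h.comm k (i + 1) (by omega) him, mul_assoc, ih,
      mul_assoc]

theorem mul_foldProd_of_lt (h : BRelations m s) {i t : ℕ} (ht : t < i) (him : i + 1 ≤ m) :
    s (i + 1) * foldProd m s t = foldProd m s t * s i := by
  induction t with
  | zero => exact h.mul_ascProd_of_le ht him (by omega)
  | succ t ih =>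
    rw [foldProd, ← mul_assoc, ← h.comm (t + 1) (i + 1) (by omega) him, mul_assoc,
      ih (by omega), mul_assoc]

theorem mul_foldProd_of_gt (h : BRelations m s) {j t : ℕ} (hj : j < t) (ht : t ≤ m) :
    s j * foldProd m s t = foldProd m s t * s j := by
  induction t, hj using Nat.le_induction with
  | base =>
    obtain _ | k := j
    · rw [foldProd, foldProd, ascProd_of_le (by omega), ascProd_of_le (by omega)]
      calc s 0 * (s (0 + 1) * (s 0 * (s (0 + 1) * ascProd m s (0 + 1 + 1))))
          = s 0 * s 1 * s 0 * s 1 * ascProd m s (0 + 1 + 1) := by group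
        _ = s 1 * s 0 * s 1 * (s 0 * ascProd m s (0 + 1 + 1)) := by
          rw [h.braid_four (by omega)]; group
        _ = _ := by rw [h.mul_ascProd_of_lt (by omega) (by omega)]; group
    · rw [foldProd, foldProd]
      calc s (k + 1) * (s (k + 1 + 1) * (s (k + 1) * foldProd m s k))
          = s (k + 1) * s (k + 1 + 1) * s (k + 1) * foldProd m s k := by group
        _ = s (k + 1 + 1) * s (k + 1) * (s (k + 1 + 1) * foldProd m s k) := by
          rw [h.braid (k + 1) (by omega) ht]; group
        _ = _ := by rw [h.mul_foldProd_of_lt (by omega) ht]; group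
  | succ t ht' ih =>
    rw [foldProd, ← mul_assoc, h.comm j (t + 1) (by omega) ht, mul_assoc, ih (by omega), mul_assoc]

/-- Representatives of the left cosets of the parabolic subgroup generated by
`s 0, …, s (m - 1)`. -/
def cosetRep (m : ℕ) (s : ℕ → G) : Fin (m + 2) ⊕ Fin m → G :=
  Sum.elim (fun a => ascProd m s a) (fun t => foldProd m s (t + 1))

theorem mul_cosetRep (h : BRelations m s) {P : Subgroup G} (hP : ∀ j < m, s j ∈ P)
    {j : ℕ} (hj : j ≤ m) (x : Fin (m + 2) ⊕ Fin m) :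
    ∃ y, ∃ p ∈ P, s j * cosetRep m s x = cosetRep m s y * p := by
  rcases x with ⟨a, ha⟩ | ⟨t, ht⟩
  · simp only [cosetRep, Sum.elim_inl]
    rcases lt_trichotomy (j + 1) a with hja | hja | hja
    · exact ⟨.inl ⟨a, ha⟩, s j, hP j (by omega), h.mul_ascProd_of_lt hja (by omega)⟩
    · exact ⟨.inl ⟨j, by omega⟩, 1, P.one_mem, by simp [← hja, ascProd_of_le hj]⟩
    · obtain rfl | hlt := (show a ≤ j by omega).eq_or_lt
      · refine ⟨.inl ⟨a + 1, by omega⟩, 1, P.one_mem, ?_⟩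
        rw [ascProd_of_le hj, ← mul_assoc, h.sq a hj]
        simp
      · obtain ⟨i, rfl⟩ : ∃ i, j = i + 1 := ⟨j - 1, by omega⟩
        obtain rfl | hi := Nat.eq_zero_or_pos i
        · obtain rfl : a = 0 := by omega
          exact ⟨.inr ⟨0, by omega⟩, 1, P.one_mem, by simp [foldProd]⟩
        · exact ⟨.inl ⟨a, ha⟩, s i, hP i (by omega), h.mul_ascProd_of_le hi hj (by omega)⟩
  · simp only [cosetRep, Sum.elim_inr]
    rcases lt_trichotomy j (t + 1) with hjt | rfl | hjt
    · exact ⟨.inr ⟨t, ht⟩, s j, hP j (by omega), h.mul_foldProd_of_gt hjt (by omega)⟩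
    · have key : s (t + 1) * foldProd m s (t + 1) = foldProd m s t := by
        rw [foldProd, ← mul_assoc, h.sq _ hj, one_mul]
      obtain _ | t := t
      · exact ⟨.inl ⟨0, by omega⟩, 1, P.one_mem, by rw [key]; simp [foldProd]⟩
      · exact ⟨.inr ⟨t, by omega⟩, 1, P.one_mem, by rw [key]; simp⟩
    · obtain ⟨i, rfl⟩ : ∃ i, j = i + 1 := ⟨j - 1, by omega⟩
      obtain rfl | hi := (show t + 1 ≤ i by omega).eq_or_lt
      · exact ⟨.inr ⟨t + 1, by omega⟩, 1, P.one_mem, by simp [foldProd]⟩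
      · exact ⟨.inr ⟨t, ht⟩, s i, hP i (by omega), h.mul_foldProd_of_lt hi hj⟩

end BRelations

/-- The simple reflections of `W(Bₙ)`, indexed by natural numbers. -/
def natSimple (n : ℕ) (j : ℕ) : (BMat n).Group :=
  if h : j < n then (BMat n).simple ⟨j, h⟩ else 1

theorem simple_mul_simple_pow_BMat {n i j k : ℕ} (hi : i < n) (hj : j < n)
    (hk : BMat n ⟨i, hi⟩ ⟨j, hj⟩ = k) : (natSimple n i * natSimple n j) ^ k = 1 := by
  have := (BMat n).toCoxeterSystem.simple_mul_simple_pow ⟨i, hi⟩ ⟨j, hj⟩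
  rw [hk] at this
  simpa [natSimple, hi, hj, CoxeterMatrix.toCoxeterSystem_simple] using this

theorem mul_self_natSimple {n j : ℕ} (hj : j < n) : natSimple n j * natSimple n j = 1 := by
  simpa using simple_mul_simple_pow_BMat hj hj ((BMat n).diagonal _)

theorem BMat_apply {n : ℕ} (i j : Fin n) : BMat n i j =
    if i = j then 1
    else if (i : ℕ) = 0 ∧ (j : ℕ) = 1 ∨ (j : ℕ) = 0 ∧ (i : ℕ) = 1 then 4
    else if (j : ℕ) + 1 = i ∨ (i : ℕ) + 1 = j then 3
    else 2 := rfl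

theorem bRelations_natSimple (m : ℕ) : BRelations m (natSimple (m + 1)) := by
  have inv : ∀ j ≤ m, (natSimple (m + 1) j)⁻¹ = natSimple (m + 1) j := fun j hj =>
    inv_eq_of_mul_eq_one_left (mul_self_natSimple (by omega))
  refine ⟨fun j hj => mul_self_natSimple (by omega), fun i j hij hj => ?_, fun i hi him => ?_,
    fun hm => ?_⟩
  · have := simple_mul_simple_pow_BMat (n := m + 1) (i := i) (j := j) (k := 2)
      (by omega) (by omega) (by
        rw [BMat_apply, if_neg (by simp; omega), if_neg (by simp; omega),
          if_neg (by simp; omega)])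
    rw [pow_two, mul_eq_one_iff_eq_inv, mul_inv_rev, inv i (by omega), inv j (by omega)] at this
    exact this
  · have := simple_mul_simple_pow_BMat (n := m + 1) (i := i) (j := i + 1) (k := 3)
      (by omega) (by omega) (by
        rw [BMat_apply, if_neg (by simp), if_neg (by simp; omega), if_pos (by simp)])
    rw [← mul_inv_eq_one]
    simp only [mul_inv_rev, inv i (by omega), inv (i + 1) (by omega)]
    rw [← this]
    simp only [pow_succ, pow_zero, one_mul, mul_assoc]
  · have := simple_mul_simple_pow_BMat (n := m + 1) (i := 0) (j := 1) (k := 4)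
      (by omega) (by omega) (by rw [BMat_apply, if_neg (by simp), if_pos (by simp)])
    rw [← mul_inv_eq_one]
    simp only [mul_inv_rev, inv 0 (by omega), inv 1 hm]
    rw [← this]
    simp only [pow_succ, pow_zero, one_mul, mul_assoc]

theorem isLiftable_simple_castSucc (n : ℕ) :
    (BMat n).IsLiftable fun i => (BMat (n + 1)).simple i.castSucc := by
  intro i j
  have := (BMat (n + 1)).toCoxeterSystem.simple_mul_simple_pow i.castSucc j.castSucc
  have h : BMat (n + 1) i.castSucc j.castSucc = BMat n i j := by simp [BMat_apply]
  rwa [h, CoxeterMatrix.toCoxeterSystem_simple] at this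

/-- The homomorphism of `W(Bₙ)` onto a parabolic subgroup of `W(Bₙ₊₁)`. -/
noncomputable def parabolicHom (n : ℕ) : (BMat n).Group →* (BMat (n + 1)).Group :=
  (BMat n).toCoxeterSystem.lift ⟨_, isLiftable_simple_castSucc n⟩

theorem natSimple_mem_range_parabolicHom {m j : ℕ} (hj : j < m) :
    natSimple (m + 1) j ∈ (parabolicHom m).range := by
  refine ⟨(BMat m).simple ⟨j, hj⟩, ?_⟩
  rw [← CoxeterMatrix.toCoxeterSystem_simple, parabolicHom, CoxeterSystem.lift_apply_simple]
  simp [natSimple, show j < m + 1 by omega]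

theorem surjective_cosetRep_mul_parabolicHom (m : ℕ) :
    Function.Surjective fun p : (Fin (m + 2) ⊕ Fin m) × (BMat m).Group =>
      BRelations.cosetRep m (natSimple (m + 1)) p.1 * parabolicHom m p.2 := by
  intro w
  induction w using (BMat (m + 1)).toCoxeterSystem.simple_induction_left with
  | one => exact ⟨(.inl (Fin.last _), 1), by simp [BRelations.cosetRep, BRelations.ascProd_top]⟩
  | mul_simple_left w i ih =>
    obtain ⟨⟨x, v⟩, rfl⟩ := ih
    obtain ⟨y, _, ⟨u, rfl⟩, h⟩ := (bRelations_natSimple m).mul_cosetRep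
      (fun j hj => natSimple_mem_range_parabolicHom hj) (Nat.le_of_lt_succ i.2) x
    refine ⟨(y, u * v), ?_⟩
    simp only [natSimple, i.2, dif_pos, Fin.eta] at h
    simp only [map_mul, ← mul_assoc, ← h, CoxeterMatrix.toCoxeterSystem_simple]

theorem finite_and_card_BMat_group_le (n : ℕ) :
    Finite (BMat n).Group ∧ Nat.card (BMat n).Group ≤ 2 ^ n * n.factorial := by
  induction n with
  | zero =>
    have : Subsingleton (BMat 0).Group := ⟨fun a b => by
      have h : ∀ w : (BMat 0).Group, w = 1 := fun w => by
        induction w using (BMat 0).toCoxeterSystem.simple_induction_left with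
        | one => rfl
        | mul_simple_left w i _ => exact i.elim0
      rw [h a, h b]⟩
    exact ⟨inferInstance, by simp⟩
  | succ m ih =>
    obtain ⟨_, hcard⟩ := ih
    have hs := surjective_cosetRep_mul_parabolicHom m
    refine ⟨Finite.of_surjective _ hs, (Nat.card_le_card_of_surjective _ hs).trans ?_⟩
    rw [Nat.card_prod, Nat.card_sum, Nat.card_fin, Nat.card_fin, Nat.factorial_succ, pow_succ]
    calc _ ≤ (m + 2 + m) * (2 ^ m * m.factorial) := Nat.mul_le_mul_left _ hcard
      _ = _ := by ring

/-- Multiplication of the second coordinate by a sign. -/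
def signMul (n : ℕ) : ℤˣ →* Equiv.Perm (Fin n × ℤˣ) where
  toFun u := (Equiv.refl _).prodCongr (Equiv.mulLeft u)
  map_one' := by ext <;> simp
  map_mul' u v := by ext <;> simp [mul_assoc]

@[simp]
theorem signMul_apply {n : ℕ} (u : ℤˣ) (p : Fin n × ℤˣ) : signMul n u p = (p.1, u * p.2) := rfl

/-- The hyperoctahedral group: the permutations of the signed points `Fin n × ℤˣ` that commute
with changes of sign. -/
def Hyperoctahedral (n : ℕ) : Subgroup (Equiv.Perm (Fin n × ℤˣ)) :=
  Subgroup.centralizer (signMul n).range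

namespace Hyperoctahedral

variable {n : ℕ}

theorem mem_iff {σ : Equiv.Perm (Fin n × ℤˣ)} :
    σ ∈ Hyperoctahedral n ↔ ∀ u, Commute σ (signMul n u) := by
  simp only [Hyperoctahedral, Subgroup.mem_centralizer_iff, MonoidHom.coe_range,
    Set.forall_mem_range]
  exact forall_congr' fun u => eq_comm

/-- Permutations of the points, acting without changes of sign. -/
def permPart (n : ℕ) : Equiv.Perm (Fin n) →* Hyperoctahedral n where
  toFun π := ⟨π.prodCongr (Equiv.refl _), mem_iff.2 fun u => by ext <;> simp⟩
  map_one' := by ext <;> simp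
  map_mul' u v := by ext <;> simp

/-- Changes of signs, fixing the underlying points. -/
def signPart (n : ℕ) : (Fin n → ℤˣ) →* Hyperoctahedral n where
  toFun e := ⟨Equiv.prodShear (Equiv.refl _) fun x => Equiv.mulLeft (e x),
    mem_iff.2 fun u => by ext <;> simp [mul_left_comm]⟩
  map_one' := by ext <;> simp
  map_mul' u v := by ext <;> simp

@[simp]
theorem permPart_apply (π : Equiv.Perm (Fin n)) (p : Fin n × ℤˣ) :
    (permPart n π : Equiv.Perm (Fin n × ℤˣ)) p = (π p.1, p.2) := rfl

@[simp]
theorem signPart_apply (e : Fin n → ℤˣ) (p : Fin n × ℤˣ) :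
    (signPart n e : Equiv.Perm (Fin n × ℤˣ)) p = (p.1, e p.1 * p.2) := rfl

theorem permPart_mul_signPart (π : Equiv.Perm (Fin n)) (e : Fin n → ℤˣ) :
    permPart n π * signPart n (e ∘ π) = signPart n e * permPart n π := by
  ext <;> simp

theorem bijective_permPart_mul_signPart (n : ℕ) :
    Function.Bijective fun p : Equiv.Perm (Fin n) × (Fin n → ℤˣ) =>
      permPart n p.1 * signPart n p.2 := by
  constructor
  · rintro ⟨π, e⟩ ⟨π', e'⟩ h
    have key : ∀ x, (π x, e x) = (π' x, e' x) := fun x => by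
      simpa using congrArg (fun σ : Hyperoctahedral n => σ.1 (x, 1)) h
    simp only [Prod.mk.injEq] at key
    exact Prod.ext (Equiv.ext fun x => (key x).1) (funext fun x => (key x).2)
  · have hσ : ∀ (σ : Hyperoctahedral n) (x : Fin n) (u : ℤˣ),
        σ.1 (x, u) = ((σ.1 (x, 1)).1, u * (σ.1 (x, 1)).2) := fun σ x u => by
      simpa using DFunLike.congr_fun (mem_iff.1 σ.2 u) (x, 1)
    intro σ
    refine ⟨⟨⟨fun x => (σ.1 (x, 1)).1, fun x => (σ⁻¹.1 (x, 1)).1, fun x => ?_, fun x => ?_⟩,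
      fun x => (σ.1 (x, 1)).2⟩, ?_⟩
    · have := congrArg Prod.fst (hσ σ⁻¹ (σ.1 (x, 1)).1 (σ.1 (x, 1)).2)
      simpa using this.symm
    · have := congrArg Prod.fst (hσ σ (σ⁻¹.1 (x, 1)).1 (σ⁻¹.1 (x, 1)).2)
      simpa using this.symm
    · refine Subtype.ext (Equiv.ext fun ⟨x, u⟩ => ?_)
      rw [hσ σ x u]
      simp [mul_comm]

theorem card_eq (n : ℕ) : Nat.card (Hyperoctahedral n) = 2 ^ n * n.factorial := by
  rw [← Nat.card_congr (Equiv.ofBijective _ (bijective_permPart_mul_signPart n)), Nat.card_prod,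
    Nat.card_perm, Nat.card_fun]
  simp [mul_comm, Nat.card_eq_fintype_card]

/-- The standard generators of the hyperoctahedral group: one change of sign and the adjacent
transpositions. -/
def generator (m : ℕ) (i : Fin (m + 1)) : Hyperoctahedral (m + 1) :=
  Fin.cases (signPart (m + 1) (Pi.mulSingle 0 (-1)))
    (fun i => permPart (m + 1) (Equiv.swap i.castSucc i.succ)) i

theorem generator_zero (m : ℕ) :
    generator m 0 = signPart (m + 1) (Pi.mulSingle 0 (-1)) := rfl

theorem generator_succ {m : ℕ} (i : Fin m) :
    generator m i.succ = permPart (m + 1) (Equiv.swap i.castSucc i.succ) := rfl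

theorem generator_mul_self {m : ℕ} (i : Fin (m + 1)) : generator m i * generator m i = 1 := by
  cases i using Fin.cases with
  | zero =>
    rw [generator_zero, ← map_mul, ← Pi.mulSingle_mul]
    simp
  | succ i => simp [generator_succ, ← map_mul]

theorem signPart_mul_permPart_swap_pow_four (e : Fin n → ℤˣ) (i j : Fin n) :
    (signPart n e * permPart n (Equiv.swap i j)) ^ 4 = 1 := by
  have h := permPart_mul_signPart (Equiv.swap i j) (e ∘ Equiv.swap i j)
  have he : (e ∘ Equiv.swap i j) ∘ Equiv.swap i j = e := by ext x; simp
  rw [he] at h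
  have hsq : (signPart n e * permPart n (Equiv.swap i j)) ^ 2 =
      signPart n (e * e ∘ Equiv.swap i j) := by
    rw [pow_two, mul_assoc, ← mul_assoc (permPart _ _), h, mul_assoc, ← map_mul (permPart n),
      Equiv.swap_mul_self, map_one, mul_one, map_mul]
  rw [show 4 = 2 * 2 from rfl, pow_mul, hsq, ← map_pow]
  convert map_one (signPart n)
  ext x
  simp

theorem generator_mul_pow_of_lt {m : ℕ} {i j : Fin (m + 1)} (hij : i < j) :
    (generator m i * generator m j) ^ BMat (m + 1) i j = 1 := by
  have sq_of_comm : Commute (generator m i) (generator m j) →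
      (generator m i * generator m j) ^ 2 = 1 := fun h => by
    rw [h.mul_pow, pow_two, pow_two, generator_mul_self, generator_mul_self, one_mul]
  rw [BMat_apply, if_neg hij.ne]
  obtain ⟨j, rfl⟩ := Fin.exists_succ_eq.2 (Fin.ne_zero_of_lt hij)
  cases i using Fin.cases with
  | zero =>
    by_cases hj : (j : ℕ) = 0
    · rw [if_pos (by simp [hj]), generator_zero, generator_succ]
      exact signPart_mul_permPart_swap_pow_four _ _ _
    · rw [if_neg (by simp [hj]), if_neg (by simp [hj])]
      refine sq_of_comm ?_
      have := permPart_mul_signPart (Equiv.swap j.castSucc j.succ) (Pi.mulSingle 0 (-1))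
      have h : (Pi.mulSingle 0 (-1) : Fin (m + 1) → ℤˣ) ∘ Equiv.swap j.castSucc j.succ =
          Pi.mulSingle 0 (-1) := by
        rw [Pi.mulSingle_comp_equiv, Equiv.symm_swap, Equiv.swap_apply_of_ne_of_ne]
        · simpa [Fin.ext_iff, eq_comm] using hj
        · exact (Fin.succ_ne_zero j).symm
      rw [h] at this
      exact this.symm
  | succ i =>
    have hij' : (i : ℕ) < j := by simpa using hij
    rw [if_neg (by simp)]
    by_cases hj : (i : ℕ) + 1 = j
    · rw [if_pos (by simp [hj]), generator_succ, generator_succ, ← map_mul, ← map_pow]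
      have hs : j.castSucc = i.succ := Fin.ext hj.symm
      rw [hs, Equiv.swap_comm i.castSucc]
      have := (Equiv.Perm.isThreeCycle_swap_mul_swap_same (a := i.succ) (b := i.castSucc)
        (c := j.succ) (by simp [Fin.ext_iff]) (by simp [Fin.ext_iff]; omega)
        (by simp [Fin.ext_iff]; omega)).orderOf
      rw [← this, pow_orderOf_eq_one, map_one]
    · rw [if_neg (by simp; omega)]
      refine sq_of_comm (Commute.map (Equiv.Perm.Disjoint.commute ?_) (permPart (m + 1)))
      rw [Equiv.Perm.disjoint_iff_disjoint_support, Equiv.Perm.support_swap (by simp [Fin.ext_iff]),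
        Equiv.Perm.support_swap (by simp [Fin.ext_iff])]
      simp [Fin.ext_iff]
      omega

theorem isLiftable_generator (m : ℕ) : (BMat (m + 1)).IsLiftable (generator m) := by
  intro i j
  rcases lt_trichotomy i j with h | rfl | h
  · exact generator_mul_pow_of_lt h
  · rw [generator_mul_self, one_pow]
  · have hji := generator_mul_pow_of_lt h
    rw [(BMat (m + 1)).symmetric] at hji
    have hinv : ∀ k, (generator m k)⁻¹ = generator m k := fun k =>
      inv_eq_of_mul_eq_one_left (generator_mul_self k)
    rw [← inv_eq_one, ← inv_pow, mul_inv_rev, hinv, hinv]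
    exact hji

/-- The homomorphism from `W(Bₙ)` onto the hyperoctahedral group. -/
noncomputable def ofCoxeter (m : ℕ) : (BMat (m + 1)).Group →* Hyperoctahedral (m + 1) :=
  (BMat (m + 1)).toCoxeterSystem.lift ⟨_, isLiftable_generator m⟩

theorem generator_mem_range {m : ℕ} (i : Fin (m + 1)) : generator m i ∈ (ofCoxeter m).range :=
  ⟨(BMat (m + 1)).toCoxeterSystem.simple i, CoxeterSystem.lift_apply_simple _ _ i⟩

theorem permPart_mem_range {m : ℕ} (π : Equiv.Perm (Fin (m + 1))) :
    permPart (m + 1) π ∈ (ofCoxeter m).range := by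
  have h : Submonoid.closure (Set.range fun i : Fin m ↦ Equiv.swap i.castSucc i.succ) ≤
      ((ofCoxeter m).range.comap (permPart (m + 1))).toSubmonoid := by
    rw [Submonoid.closure_le]
    rintro _ ⟨i, rfl⟩
    exact generator_mem_range i.succ
  rw [Equiv.Perm.mclosure_swap_castSucc_succ] at h
  exact h (Submonoid.mem_top π)

theorem signPart_mem_range {m : ℕ} (e : Fin (m + 1) → ℤˣ) :
    signPart (m + 1) e ∈ (ofCoxeter m).range := by
  suffices h : ∀ i, signPart (m + 1) (Pi.mulSingle i (-1)) ∈ (ofCoxeter m).range by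
    refine Subgroup.pi_mem_of_mulSingle_mem (H := (ofCoxeter m).range.comap (signPart (m + 1))) e
      fun i => ?_
    rcases Int.units_eq_one_or (e i) with hi | hi
    · rw [hi, Pi.mulSingle_one]
      exact Subgroup.one_mem _
    · rw [hi]
      exact h i
  intro i
  have h := permPart_mul_signPart (Equiv.swap 0 i) (Pi.mulSingle i (-1))
  have hs : (Pi.mulSingle i (-1) : Fin (m + 1) → ℤˣ) ∘ Equiv.swap 0 i = Pi.mulSingle 0 (-1) := by
    rw [Pi.mulSingle_comp_equiv, Equiv.symm_swap, Equiv.swap_apply_right]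
  rw [hs, ← mul_inv_eq_iff_eq_mul] at h
  rw [← h]
  exact mul_mem (mul_mem (permPart_mem_range _) (generator_mem_range 0))
    (inv_mem (permPart_mem_range _))

theorem ofCoxeter_surjective (m : ℕ) : Function.Surjective (ofCoxeter m) := by
  rw [← MonoidHom.range_eq_top, eq_top_iff]
  intro σ _
  obtain ⟨⟨π, e⟩, rfl⟩ := (bijective_permPart_mul_signPart (m + 1)).2 σ
  exact mul_mem (permPart_mem_range π) (signPart_mem_range e)

theorem ofCoxeter_bijective (m : ℕ) : Function.Bijective (ofCoxeter m) := by
  obtain ⟨_, hcard⟩ := finite_and_card_BMat_group_le (m + 1)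
  refine (Nat.bijective_iff_surjective_and_card _).2 ⟨ofCoxeter_surjective m, le_antisymm ?_ ?_⟩
  · rwa [card_eq]
  · exact Nat.card_le_card_of_surjective _ (ofCoxeter_surjective m)

end Hyperoctahedral

theorem exists_equiv_of_map_univ_eq {α β γ : Type*} [Fintype α] [Fintype β] {f : α → γ}
    {g : β → γ} (h : Finset.univ.val.map f = Finset.univ.val.map g) :
    ∃ θ : α ≃ β, ∀ a, g (θ a) = f a := by
  classical
  have key : ∀ c, Nonempty ({a // f a = c} ≃ {b // g b = c}) := fun c => by
    refine Fintype.card_eq.1 ?_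
    have := congrArg (Multiset.count c) h
    simp only [Multiset.count_map, eq_comm (a := c)] at this
    rw [Fintype.card_subtype, Fintype.card_subtype]
    exact this
  exact ⟨Equiv.ofFiberEquiv fun c => (key c).some, Equiv.ofFiberEquiv_map _⟩

namespace MulAction

variable {A X Y : Type*} [CommGroup A] [MulAction A X] [MulAction A Y]

/-- The multiset of the stabilizers of the orbits of an action of a commutative group. -/
noncomputable def orbitType (A X : Type*) [CommGroup A] [MulAction A X] [Finite X] :
    Multiset (Subgroup A) :=
  letI := Fintype.ofFinite (orbitRel.Quotient A X)
  (Finset.univ : Finset (orbitRel.Quotient A X)).val.map fun ω => stabilizer A ω.out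

theorem stabilizer_eq_of_mem_orbit {x y : X} (h : x ∈ orbit A y) :
    stabilizer A x = stabilizer A y := by
  obtain ⟨a, rfl⟩ := h
  ext b
  simp only [mem_stabilizer_iff]
  rw [smul_comm, smul_left_cancel_iff]

theorem stabilizer_out_mk (x : X) :
    stabilizer A (Quotient.out (Quotient.mk'' x : orbitRel.Quotient A X)) = stabilizer A x :=
  stabilizer_eq_of_mem_orbit (Quotient.mk_out (s := orbitRel A X) x)

theorem orbitType_eq_of_bijective [Finite X] {ι : Type*} [Fintype ι] (f : ι → X)
    (hf : Function.Bijective fun i => (Quotient.mk'' (f i) : orbitRel.Quotient A X)) :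
    orbitType A X = Finset.univ.val.map fun i => stabilizer A (f i) := by
  let := Fintype.ofFinite (orbitRel.Quotient A X)
  rw [orbitType, ← (Multiset.bijective_iff_map_univ_eq_univ _).1 hf, Multiset.map_map]
  exact Multiset.map_congr rfl fun i _ => stabilizer_out_mk (f i)

theorem orbitType_congr [Finite X] [Finite Y] (e : X ≃ Y) (he : ∀ (a : A) x, e (a • x) = a • e x) :
    orbitType A X = orbitType A Y := by
  let := Fintype.ofFinite (orbitRel.Quotient A X)
  have hmem : ∀ x y, e x ∈ orbit A (e y) ↔ x ∈ orbit A y := fun x y => by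
    simp only [mem_orbit_iff, ← he, e.apply_eq_iff_eq]
  have hout : ∀ x : X, x ∈ orbit A (Quotient.out (Quotient.mk'' x : orbitRel.Quotient A X)) :=
    fun x => mem_orbit_symm.1 (Quotient.mk_out (s := orbitRel A X) x)
  rw [orbitType_eq_of_bijective (fun ω : orbitRel.Quotient A X => e ω.out)]
  · refine Multiset.map_congr rfl fun ω _ => ?_
    ext a
    simp [mem_stabilizer_iff, ← he]
  · constructor
    · intro ω ω' h
      rw [Quotient.eq'', orbitRel_apply, hmem] at h
      rw [← Quotient.out_eq' ω, ← Quotient.out_eq' ω', Quotient.eq'']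
      exact h
    · intro ω
      induction ω using Quotient.inductionOn' with
      | h y =>
        refine ⟨Quotient.mk'' (e.symm y), ?_⟩
        rw [Quotient.eq'', orbitRel_apply, mem_orbit_symm]
        simpa using (hmem _ _).2 (hout (e.symm y))

theorem mk_smul_out (ω : orbitRel.Quotient A X) (a : A) :
    (Quotient.mk'' (a • ω.out) : orbitRel.Quotient A X) = ω := by
  conv_rhs => rw [← Quotient.out_eq' ω]
  exact Quotient.eq''.2 ⟨a, rfl⟩

theorem exists_smul_out_eq (x : X) :
    ∃ a : A, a • Quotient.out (Quotient.mk'' x : orbitRel.Quotient A X) = x :=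
  mem_orbit_symm.1 (Quotient.mk_out (s := orbitRel A X) x)

theorem exists_equiv_of_orbitType_eq [Finite X] [Finite Y] (h : orbitType A X = orbitType A Y) :
    ∃ e : X ≃ Y, ∀ (a : A) x, e (a • x) = a • e x := by
  let := Fintype.ofFinite (orbitRel.Quotient A X)
  let := Fintype.ofFinite (orbitRel.Quotient A Y)
  obtain ⟨θ, hθ⟩ := exists_equiv_of_map_univ_eq h
  have hstab : ∀ (ω : orbitRel.Quotient A X) (a b : A),
      a • (θ ω).out = b • (θ ω).out ↔ a • ω.out = b • ω.out := fun ω a b => by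
    have := SetLike.ext_iff.1 (hθ ω) (b⁻¹ * a)
    simpa only [mem_stabilizer_iff, mul_smul, inv_smul_eq_iff] using this
  choose c hc using exists_smul_out_eq (A := A) (X := X)
  let f : X → Y := fun x => c x • (θ (Quotient.mk'' x)).out
  have hf : ∀ (a : A) (ω : orbitRel.Quotient A X), f (a • ω.out) = a • (θ ω).out := fun a ω => by
    have h1 := hc (a • ω.out)
    simp only [f]
    rw [mk_smul_out] at h1 ⊢
    exact (hstab ω _ _).2 h1
  have hbij : Function.Bijective f := by
    constructor
    · intro x x' hxx
      have hω := congrArg (fun y => (Quotient.mk'' y : orbitRel.Quotient A Y)) hxx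
      simp only [f, mk_smul_out] at hω
      have hω' := θ.injective hω
      simp only [f] at hxx
      rw [← hω', hstab] at hxx
      rw [← hc x, ← hc x', hxx, hω']
    · intro y
      obtain ⟨a, ha⟩ := exists_smul_out_eq (A := A) y
      exact ⟨a • (θ.symm (Quotient.mk'' y)).out, by rw [hf, θ.apply_symm_apply, ha]⟩
  refine ⟨Equiv.ofBijective f hbij, fun a x => ?_⟩
  simp only [Equiv.ofBijective_apply]
  conv_lhs => rw [← hc x, ← mul_smul, hf, mul_smul]

theorem sum_index_orbitType (A X : Type*) [CommGroup A] [MulAction A X] [Finite X] :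
    ((orbitType A X).map Subgroup.index).sum = Nat.card X := by
  let := Fintype.ofFinite (orbitRel.Quotient A X)
  rw [orbitType, Multiset.map_map, Nat.card_congr (selfEquivSigmaOrbitsQuotientStabilizer A X)]
  have : ∀ ω : orbitRel.Quotient A X, Finite (A ⧸ stabilizer A ω.out) := fun ω =>
    Finite.of_equiv _ (orbitEquivQuotientStabilizer A ω.out)
  rw [Nat.card_sigma]
  rfl

theorem exists_orbitType_eq_replicate [Finite X] (hX : ∀ x : X, stabilizer A x = ⊥) :
    ∃ k, orbitType A X = Multiset.replicate k ⊥ ∧ k * Nat.card A = Nat.card X := by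
  have hrep : orbitType A X = Multiset.replicate (orbitType A X).card ⊥ := by
    refine Multiset.eq_replicate_card.2 fun B hB => ?_
    obtain ⟨ω, -, rfl⟩ := Multiset.mem_map.1 hB
    exact hX _
  refine ⟨_, hrep, ?_⟩
  rw [← sum_index_orbitType A X, hrep]
  simp

theorem exists_equiv_of_stabilizer_eq_bot [Finite A] [Finite X] [Finite Y]
    (hX : ∀ x : X, stabilizer A x = ⊥) (hY : ∀ y : Y, stabilizer A y = ⊥)
    (h : Nat.card X = Nat.card Y) : ∃ e : X ≃ Y, ∀ (a : A) x, e (a • x) = a • e x := by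
  obtain ⟨k, hk, hk'⟩ := exists_orbitType_eq_replicate hX
  obtain ⟨l, hl, hl'⟩ := exists_orbitType_eq_replicate hY
  refine exists_equiv_of_orbitType_eq ?_
  rw [hk, hl, Nat.eq_of_mul_eq_mul_right Nat.card_pos (hk'.trans (h.trans hl'.symm))]

theorem orbitType_sigma_quotient {ι : Type*} [Fintype ι] (B : ι → Subgroup A)
    [Finite (Σ i, A ⧸ B i)] : orbitType A (Σ i, A ⧸ B i) = Finset.univ.val.map B := by
  rw [orbitType_eq_of_bijective fun i => (⟨i, (1 : A)⟩ : Σ i, A ⧸ B i)]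
  · refine Multiset.map_congr rfl fun i _ => ?_
    ext a
    conv_rhs => rw [← stabilizer_quotient (B i)]
    simp only [mem_stabilizer_iff, Sigma.smul_mk, Sigma.mk.injEq, heq_eq_eq, true_and]
  · constructor
    · intro i j h
      obtain ⟨a, ha⟩ := Quotient.eq''.1 h
      exact (congrArg Sigma.fst ha).symm
    · intro ω
      induction ω using Quotient.inductionOn' with
      | h y =>
        obtain ⟨i, q⟩ := y
        obtain ⟨a, rfl⟩ := QuotientGroup.mk_surjective q
        refine ⟨i, Eq.symm (Quotient.eq''.2 ⟨a, ?_⟩)⟩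
        simp [-QuotientGroup.mk_one]

end MulAction

/-- The group generated by a permutation of signed points and the changes of all signs acts through
this group. -/
abbrev CycleGroup : Type := Multiplicative ℤ × ℤˣ

namespace CycleGroup

/-- The stabilizer of a signed point whose cycle has length `p.1` and sign `p.2`. -/
def cycleStabilizer (p : ℕ × ℤˣ) : Subgroup CycleGroup :=
  Subgroup.zpowers (Multiplicative.ofAdd (p.1 : ℤ), p.2)

theorem mem_cycleStabilizer {p : ℕ × ℤˣ} {a : CycleGroup} :
    a ∈ cycleStabilizer p ↔ ∃ m : ℤ, m * p.1 = a.1.toAdd ∧ p.2 ^ m = a.2 := by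
  simp only [cycleStabilizer, Subgroup.mem_zpowers_iff, Prod.ext_iff, Prod.pow_fst, Prod.pow_snd,
    ← ofAdd_zsmul, smul_eq_mul]
  rfl

theorem eq_one_of_mem_cycleStabilizer {p : ℕ × ℤˣ} (hp : 0 < p.1) {u : ℤˣ}
    (h : ((1, u) : CycleGroup) ∈ cycleStabilizer p) : u = 1 := by
  obtain ⟨m, hm, rfl⟩ := mem_cycleStabilizer.1 h
  obtain rfl : m = 0 := by simpa [hp.ne'] using hm
  simp

theorem index_cycleStabilizer {p : ℕ × ℤˣ} (hp : 0 < p.1) :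
    (cycleStabilizer p).index = 2 * p.1 := by
  let f := MonoidHom.fst (Multiplicative ℤ) ℤˣ
  have hmap : (cycleStabilizer p ⊔ f.ker).index = p.1 := by
    have h := (cycleStabilizer p).index_map f
    rw [MonoidHom.range_eq_top.2 Prod.fst_surjective, Subgroup.index_top, mul_one,
      cycleStabilizer, MonoidHom.map_zpowers] at h
    rw [cycleStabilizer, ← h]
    exact Int.index_zmultiples (p.1 : ℤ)
  have hdisj : cycleStabilizer p ⊓ f.ker = ⊥ := by
    rw [eq_bot_iff]
    rintro ⟨a, u⟩ ⟨h, ha⟩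
    obtain rfl : a = 1 := ha
    rw [eq_one_of_mem_cycleStabilizer hp h]
    rfl
  have hker : Nat.card f.ker = 2 := by
    rw [MonoidHom.ker_fst, Nat.card_congr (Subgroup.prodEquiv _ _).toEquiv]
    simp
  rw [← Subgroup.relIndex_mul_index (le_sup_left : _ ≤ cycleStabilizer p ⊔ f.ker), hmap,
    Subgroup.relIndex_sup_left, ← Subgroup.inf_relIndex_right, hdisj, Subgroup.relIndex_bot_left,
    hker]

theorem injOn_cycleStabilizer : Set.InjOn cycleStabilizer {p | 0 < p.1} := by
  rintro ⟨k, s⟩ hk ⟨l, t⟩ hl h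
  obtain rfl : k = l := by
    have := congrArg Subgroup.index h
    rw [index_cycleStabilizer hk, index_cycleStabilizer hl] at this
    simpa using this
  have hmem : ((Multiplicative.ofAdd (k : ℤ), s) : CycleGroup) ∈ cycleStabilizer (k, t) :=
    h ▸ Subgroup.mem_zpowers _
  obtain ⟨m, hm, rfl⟩ := mem_cycleStabilizer.1 hmem
  obtain rfl : m = 1 := by simpa [(show k ≠ 0 from hk.ne')] using hm
  simp

theorem exists_eq_cycleStabilizer {B : Subgroup CycleGroup} (hB : B.index ≠ 0)
    (hfree : ∀ u : ℤˣ, ((1, u) : CycleGroup) ∈ B → u = 1) :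
    ∃ p : ℕ × ℤˣ, 0 < p.1 ∧ cycleStabilizer p = B := by
  obtain ⟨c, hc⟩ := Int.subgroup_cyclic (Subgroup.toAddSubgroup' (B.map (MonoidHom.fst _ _)))
  have hmem : ∀ i : ℤ, (∃ u, ((Multiplicative.ofAdd i, u) : CycleGroup) ∈ B) ↔ c ∣ i := fun i => by
    rw [← Int.mem_zmultiples_iff, AddSubgroup.zmultiples_eq_closure, ← hc]
    change _ ↔ Multiplicative.ofAdd i ∈ B.map (MonoidHom.fst _ _)
    simp
  have hc0 : c ≠ 0 := by
    rintro rfl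
    obtain ⟨m, hm, -, h⟩ := Subgroup.exists_pow_mem_of_index_ne_zero hB (Multiplicative.ofAdd 1, 1)
    have : (0 : ℤ) ∣ m := (hmem m).1 ⟨1, by simpa [← ofAdd_nsmul] using h⟩
    simp at this
    omega
  obtain ⟨s, hs⟩ := (hmem c.natAbs).2 (Int.dvd_natAbs.2 dvd_rfl)
  refine ⟨(c.natAbs, s), Int.natAbs_pos.2 hc0, le_antisymm (Subgroup.zpowers_le.2 hs) ?_⟩
  rintro ⟨i, u⟩ h
  obtain ⟨m, hm⟩ := Int.natAbs_dvd.2 ((hmem i.toAdd).1 ⟨u, h⟩)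
  refine mem_cycleStabilizer.2 ⟨m, by simp [hm, mul_comm], ?_⟩
  have := hfree (u / s ^ m) (by
    convert B.div_mem h (B.zpow_mem hs m) using 1
    refine Prod.ext (Eq.symm (div_eq_one.2 ?_)) rfl
    rw [Prod.pow_fst, ← ofAdd_zsmul, smul_eq_mul, mul_comm, ← hm]
    rfl)
  exact (div_eq_one.1 this).symm

/-- The length and the sign of a cycle, recovered from the stabilizer of one of its points. -/
noncomputable def cycleOfStabilizer : Subgroup CycleGroup → ℕ × ℤˣ :=
  Function.invFunOn cycleStabilizer {p | 0 < p.1}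

theorem cycleOfStabilizer_cycleStabilizer {p : ℕ × ℤˣ} (hp : 0 < p.1) :
    cycleOfStabilizer (cycleStabilizer p) = p :=
  injOn_cycleStabilizer.leftInvOn_invFunOn hp

end CycleGroup

namespace Hyperoctahedral

open MulAction CycleGroup

variable {n : ℕ}

/-- The signed points, on which `CycleGroup` acts through the powers of `σ` and the changes of
all signs. -/
def SignedPoints (_σ : Hyperoctahedral n) : Type := Fin n × ℤˣ

instance (σ : Hyperoctahedral n) : Finite (SignedPoints σ) :=
  inferInstanceAs (Finite (Fin n × ℤˣ))

theorem commute_zpowersHom_signMul (σ : Hyperoctahedral n) (i : Multiplicative ℤ) (u : ℤˣ) :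
    Commute (zpowersHom _ σ.1 i) (signMul n u) :=
  (mem_iff.1 σ.2 u).zpow_left _

instance (σ : Hyperoctahedral n) : MulAction CycleGroup (SignedPoints σ) :=
  MulAction.compHom (Fin n × ℤˣ)
    (MonoidHom.noncommCoprod (zpowersHom _ σ.1) (signMul n) (commute_zpowersHom_signMul σ))

/-- The identification of the points on which `CycleGroup` acts with the signed points. -/
def toPoint (σ : Hyperoctahedral n) : SignedPoints σ ≃ Fin n × ℤˣ := Equiv.refl _

theorem toPoint_smul (σ : Hyperoctahedral n) (a : CycleGroup) (y : SignedPoints σ) :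
    toPoint σ (a • y) = (σ.1 ^ a.1.toAdd) (signMul n a.2 (toPoint σ y)) := rfl

theorem exists_signedPoints_equiv_of_intertwines {X : Type*} [MulAction CycleGroup X]
    (e : X ≃ Fin n × ℤˣ) (σ : Hyperoctahedral n)
    (hsign : ∀ u x, e (((1, u) : CycleGroup) • x) = signMul n u (e x))
    (hσ : ∀ x, e (((Multiplicative.ofAdd 1, 1) : CycleGroup) • x) = σ.1 (e x)) :
    ∃ e' : X ≃ SignedPoints σ, ∀ (a : CycleGroup) x, e' (a • x) = a • e' x := by
  have hperm : e.permCongrHom (MulAction.toPermHom CycleGroup X (Multiplicative.ofAdd 1, 1)) =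
      σ.1 := Equiv.ext fun p => by simpa using hσ (e.symm p)
  have hpow : ∀ (i : ℤ) x, e (((Multiplicative.ofAdd 1, 1) : CycleGroup) ^ i • x) =
      (σ.1 ^ i) (e x) := fun i x => by
    rw [← hperm, ← map_zpow, ← map_zpow]
    simp
  refine ⟨e.trans (toPoint σ).symm, fun a x => (toPoint σ).injective ?_⟩
  have ha : a = ((Multiplicative.ofAdd 1, 1) : CycleGroup) ^ a.1.toAdd * (1, a.2) := by
    ext <;> simp [← ofAdd_zsmul]
  rw [toPoint_smul]
  simp only [Equiv.trans_apply, Equiv.apply_symm_apply]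
  rw [← hsign, ← hpow, ← mul_smul, ← ha]

theorem isConj_iff_exists_equiv (σ τ : Hyperoctahedral n) :
    IsConj σ τ ↔ ∃ e : SignedPoints σ ≃ SignedPoints τ,
      ∀ (a : CycleGroup) x, e (a • x) = a • e x := by
  rw [isConj_iff]
  constructor
  · rintro ⟨g, rfl⟩
    refine exists_signedPoints_equiv_of_intertwines ((toPoint σ).trans g.1) _
      (fun u x => ?_) (fun x => ?_)
    · simpa [toPoint_smul] using DFunLike.congr_fun (mem_iff.1 g.2 u) (toPoint σ x)
    · simp [toPoint_smul]
  · rintro ⟨e, he⟩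
    let g : Equiv.Perm (Fin n × ℤˣ) := ((toPoint σ).symm.trans e).trans (toPoint τ)
    have key : ∀ (a : CycleGroup) x, g ((σ.1 ^ a.1.toAdd) (signMul n a.2 x)) =
        (τ.1 ^ a.1.toAdd) (signMul n a.2 (g x)) := fun a x => by
      have h := congrArg (toPoint τ) (he a ((toPoint σ).symm x))
      have hx : (toPoint σ).symm ((σ.1 ^ a.1.toAdd) (signMul n a.2 x)) =
          a • (toPoint σ).symm x := rfl
      rw [toPoint_smul] at h
      simp only [g, Equiv.trans_apply, hx]
      exact h
    have hg : g ∈ Hyperoctahedral n := mem_iff.2 fun u => Equiv.ext fun x => by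
      simpa using key (1, u) x
    refine ⟨⟨g, hg⟩, mul_inv_eq_iff_eq_mul.2 (Subtype.ext (Equiv.ext fun x => ?_))⟩
    simpa using key (Multiplicative.ofAdd 1, 1) x

theorem eq_one_of_smul_eq {σ : Hyperoctahedral n} {x : SignedPoints σ} {u : ℤˣ}
    (h : ((1, u) : CycleGroup) • x = x) : u = 1 := by
  have := congrArg (fun y => (toPoint σ y).2) h
  simpa [toPoint_smul] using this

theorem card_signedPoints (σ : Hyperoctahedral n) : Nat.card (SignedPoints σ) = 2 * n := by
  rw [Nat.card_congr (toPoint σ)]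
  simp [mul_comm]

theorem exists_stabilizer_eq (σ : Hyperoctahedral n) (x : SignedPoints σ) :
    ∃ p : ℕ × ℤˣ, 0 < p.1 ∧ cycleStabilizer p = stabilizer CycleGroup x := by
  refine exists_eq_cycleStabilizer ?_ fun u hu => eq_one_of_smul_eq hu
  have := Finite.of_equiv _ (orbitEquivQuotientStabilizer CycleGroup x)
  exact ne_of_gt Nat.card_pos

/-- The multiset of the lengths and signs of the cycles of `σ`. -/
noncomputable def signedCycleType (σ : Hyperoctahedral n) : Multiset (ℕ × ℤˣ) :=
  (orbitType CycleGroup (SignedPoints σ)).map cycleOfStabilizer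

theorem exists_of_mem_orbitType {σ : Hyperoctahedral n} {B : Subgroup CycleGroup}
    (hB : B ∈ orbitType CycleGroup (SignedPoints σ)) :
    ∃ p : ℕ × ℤˣ, 0 < p.1 ∧ cycleStabilizer p = B := by
  obtain ⟨ω, -, rfl⟩ := Multiset.mem_map.1 hB
  exact exists_stabilizer_eq σ _

theorem map_cycleStabilizer_signedCycleType (σ : Hyperoctahedral n) :
    (signedCycleType σ).map cycleStabilizer = orbitType CycleGroup (SignedPoints σ) := by
  rw [signedCycleType, Multiset.map_map]
  conv_rhs => rw [← Multiset.map_id (orbitType CycleGroup (SignedPoints σ))]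
  refine Multiset.map_congr rfl fun B hB => ?_
  obtain ⟨p, hp, rfl⟩ := exists_of_mem_orbitType hB
  simp [cycleOfStabilizer_cycleStabilizer hp]

theorem pos_of_mem_signedCycleType {σ : Hyperoctahedral n} {p : ℕ × ℤˣ}
    (hp : p ∈ signedCycleType σ) : 0 < p.1 := by
  obtain ⟨B, hB, rfl⟩ := Multiset.mem_map.1 hp
  obtain ⟨q, hq, rfl⟩ := exists_of_mem_orbitType hB
  rwa [cycleOfStabilizer_cycleStabilizer hq]

theorem sum_index_map_cycleStabilizer {s : Multiset (ℕ × ℤˣ)} (hs : ∀ p ∈ s, 0 < p.1) :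
    ((s.map cycleStabilizer).map Subgroup.index).sum = 2 * (s.map Prod.fst).sum := by
  rw [Multiset.map_map, ← Multiset.sum_map_mul_left]
  exact congrArg _ (Multiset.map_congr rfl fun p hp => index_cycleStabilizer (hs p hp))

theorem sum_signedCycleType (σ : Hyperoctahedral n) :
    ((signedCycleType σ).map Prod.fst).sum = n := by
  have h := sum_index_map_cycleStabilizer fun p (hp : p ∈ signedCycleType σ) =>
    pos_of_mem_signedCycleType hp
  rw [map_cycleStabilizer_signedCycleType, sum_index_orbitType] at h
  rw [card_signedPoints] at h
  omega

theorem signedCycleType_eq_iff {σ τ : Hyperoctahedral n} :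
    signedCycleType σ = signedCycleType τ ↔ IsConj σ τ := by
  rw [isConj_iff_exists_equiv]
  constructor
  · intro h
    refine exists_equiv_of_orbitType_eq ?_
    rw [← map_cycleStabilizer_signedCycleType, h, map_cycleStabilizer_signedCycleType]
  · rintro ⟨e, he⟩
    rw [signedCycleType, orbitType_congr e he, signedCycleType]

theorem exists_signedPoints_equiv {X : Type*} [Finite X] [MulAction CycleGroup X]
    (hcard : Nat.card X = 2 * n)
    (hfree : ∀ (x : X) (u : ℤˣ), ((1, u) : CycleGroup) • x = x → u = 1) :
    ∃ σ : Hyperoctahedral n, ∃ e : X ≃ SignedPoints σ,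
      ∀ (a : CycleGroup) x, e (a • x) = a • e x := by
  let : MulAction ℤˣ X := MulAction.compHom X (MonoidHom.inr (Multiplicative ℤ) ℤˣ)
  let : MulAction ℤˣ (SignedPoints (1 : Hyperoctahedral n)) :=
    MulAction.compHom _ (MonoidHom.inr (Multiplicative ℤ) ℤˣ)
  obtain ⟨e, he⟩ := exists_equiv_of_stabilizer_eq_bot (A := ℤˣ) (X := X)
    (Y := SignedPoints (1 : Hyperoctahedral n))
    (fun x => eq_bot_iff.2 fun u hu => hfree x u hu)
    (fun y => eq_bot_iff.2 fun u hu => eq_one_of_smul_eq hu)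
    (by rw [hcard, card_signedPoints])
  let f : X ≃ Fin n × ℤˣ := e.trans (toPoint 1)
  have hf : ∀ u x, f (((1, u) : CycleGroup) • x) = signMul n u (f x) := fun u x =>
    congrArg (toPoint 1) (he u x)
  let g : Equiv.Perm (Fin n × ℤˣ) :=
    f.permCongr (MulAction.toPerm ((Multiplicative.ofAdd 1, 1) : CycleGroup))
  have hg : g ∈ Hyperoctahedral n := mem_iff.2 fun u => Equiv.ext fun p => by
    obtain ⟨x, rfl⟩ := f.surjective p
    rw [Equiv.Perm.mul_apply, Equiv.Perm.mul_apply, ← hf]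
    simp only [g, Equiv.permCongr_apply, Equiv.symm_apply_apply, MulAction.toPerm_apply]
    rw [← hf, smul_comm]
  exact ⟨⟨g, hg⟩, exists_signedPoints_equiv_of_intertwines f _ hf fun x => by simp [g]⟩

theorem exists_signedCycleType_eq {s : Multiset (ℕ × ℤˣ)} (hs : ∀ p ∈ s, 0 < p.1)
    (hsum : (s.map Prod.fst).sum = n) : ∃ σ : Hyperoctahedral n, signedCycleType σ = s := by
  let X := Σ i : s, CycleGroup ⧸ cycleStabilizer i.1
  have hpos : ∀ i : s, 0 < i.1.1 := fun i => hs _ (Multiset.coe_mem)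
  have hfin : ∀ i : s, Finite (CycleGroup ⧸ cycleStabilizer i.1) := fun i =>
    Nat.finite_of_card_ne_zero (by
      change (cycleStabilizer i.1).index ≠ 0
      rw [index_cycleStabilizer (hpos i)]
      have := hpos i
      omega)
  have htype : orbitType CycleGroup X = s.map cycleStabilizer := by
    rw [orbitType_sigma_quotient]
    exact Multiset.map_univ_comp_coe s cycleStabilizer
  have hcard : Nat.card X = 2 * n := by
    rw [← sum_index_orbitType CycleGroup X, htype, sum_index_map_cycleStabilizer hs, hsum]
  obtain ⟨σ, e, he⟩ := exists_signedPoints_equiv hcard fun x u hu => by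
    obtain ⟨i, q⟩ := x
    obtain ⟨a, rfl⟩ := QuotientGroup.mk_surjective q
    refine eq_one_of_mem_cycleStabilizer (hpos i) ?_
    have hu' : (((1, u) * a : CycleGroup) : CycleGroup ⧸ cycleStabilizer i.1) = a :=
      eq_of_heq (Sigma.ext_iff.1 hu).2
    have hmem := QuotientGroup.eq.1 hu'
    rwa [mul_inv_rev, mul_right_comm, inv_mul_cancel, one_mul, inv_mem_iff] at hmem
  refine ⟨σ, ?_⟩
  rw [signedCycleType, ← orbitType_congr e he, htype, Multiset.map_map]
  conv_rhs => rw [← Multiset.map_id s]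
  exact Multiset.map_congr rfl fun p hp => cycleOfStabilizer_cycleStabilizer (hs p hp)

end Hyperoctahedral

/-- The possible signed cycle types of signed permutations of `n` points. -/
def SignedCycleTypes (n : ℕ) : Type :=
  {s : Multiset (ℕ × ℤˣ) // (∀ p ∈ s, 0 < p.1) ∧ (s.map Prod.fst).sum = n}

theorem card_conjClasses_hyperoctahedral (n : ℕ) :
    Nat.card (ConjClasses (Hyperoctahedral n)) = Nat.card (SignedCycleTypes n) := by
  refine Nat.card_congr (Equiv.ofBijective (Quotient.lift (fun σ =>
    ⟨Hyperoctahedral.signedCycleType σ, fun _ hp => Hyperoctahedral.pos_of_mem_signedCycleType hp,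
      Hyperoctahedral.sum_signedCycleType σ⟩)
    fun σ τ h => Subtype.ext (Hyperoctahedral.signedCycleType_eq_iff.2 h)) ⟨?_, ?_⟩)
  · rintro ⟨σ⟩ ⟨τ⟩ h
    exact Quotient.sound (Hyperoctahedral.signedCycleType_eq_iff.1 (congrArg Subtype.val h))
  · rintro ⟨s, hs, hsum⟩
    obtain ⟨σ, rfl⟩ := Hyperoctahedral.exists_signedCycleType_eq hs hsum
    exact ⟨ConjClasses.mk σ, rfl⟩

/-- Positive and negative cycles as a single multiset of cycles with signs. -/
def bipartitionToMultiset (q : Multiset ℕ × Multiset ℕ) : Multiset (ℕ × ℤˣ) :=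
  q.1.map (·, 1) + q.2.map (·, -1)

theorem filter_bipartitionToMultiset (q : Multiset ℕ × Multiset ℕ) (u : ℤˣ) :
    ((bipartitionToMultiset q).filter (·.2 = u)).map Prod.fst = if u = 1 then q.1 else q.2 := by
  rcases Int.units_eq_one_or u with rfl | rfl <;>
    simp [bipartitionToMultiset, Multiset.filter_map]

theorem bipartitionToMultiset_injective : Function.Injective bipartitionToMultiset := by
  intro q r h
  refine Prod.ext ?_ ?_
  · simpa [h, filter_bipartitionToMultiset] using (filter_bipartitionToMultiset q 1).symm
  · simpa [h, filter_bipartitionToMultiset] using (filter_bipartitionToMultiset q (-1)).symm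

theorem bipartitionToMultiset_filter (s : Multiset (ℕ × ℤˣ)) :
    bipartitionToMultiset ((s.filter (·.2 = 1)).map Prod.fst,
      (s.filter (¬ ·.2 = 1)).map Prod.fst) = s := by
  conv_rhs => rw [← Multiset.filter_add_not (·.2 = 1) s]
  simp only [bipartitionToMultiset, Multiset.map_map]
  congr 1
  · conv_rhs => rw [← Multiset.map_id (Multiset.filter _ s)]
    refine Multiset.map_congr rfl fun p hp => ?_
    exact Prod.ext rfl (Multiset.mem_filter.1 hp).2.symm
  · conv_rhs => rw [← Multiset.map_id (Multiset.filter _ s)]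
    refine Multiset.map_congr rfl fun p hp => ?_
    exact Prod.ext rfl ((Int.units_eq_one_or _).resolve_left (Multiset.mem_filter.1 hp).2).symm

theorem sum_fst_bipartitionToMultiset (q : Multiset ℕ × Multiset ℕ) :
    ((bipartitionToMultiset q).map Prod.fst).sum = q.1.sum + q.2.sum := by
  simp [bipartitionToMultiset]

/-- The signed cycle type with the given positive and negative cycles. -/
def signedCycleTypeOfBipartition (n : ℕ)
    (q : Σ k : Fin (n + 1), Nat.Partition k × Nat.Partition (n - k)) : SignedCycleTypes n :=
  ⟨bipartitionToMultiset (q.2.1.parts, q.2.2.parts), by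
    constructor
    · intro p hp
      rcases Multiset.mem_add.1 hp with h | h <;> obtain ⟨i, hi, rfl⟩ := Multiset.mem_map.1 h
      · exact q.2.1.parts_pos hi
      · exact q.2.2.parts_pos hi
    · rw [sum_fst_bipartitionToMultiset, q.2.1.parts_sum, q.2.2.parts_sum]
      omega⟩

theorem bijective_signedCycleTypeOfBipartition (n : ℕ) :
    Function.Bijective (signedCycleTypeOfBipartition n) := by
  constructor
  · rintro ⟨k, lam, mu⟩ ⟨l, lam', mu'⟩ h
    have h' := bipartitionToMultiset_injective (congrArg Subtype.val h)
    simp only [Prod.mk.injEq] at h'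
    obtain rfl : k = l := Fin.ext (by rw [← lam.parts_sum, h'.1, lam'.parts_sum])
    obtain rfl : lam = lam' := Nat.Partition.ext h'.1
    obtain rfl : mu = mu' := Nat.Partition.ext h'.2
    rfl
  · rintro ⟨s, hs, hsum⟩
    obtain ⟨⟨a, b⟩, rfl⟩ : ∃ q, bipartitionToMultiset q = s := ⟨_, bipartitionToMultiset_filter s⟩
    rw [sum_fst_bipartitionToMultiset] at hsum
    dsimp only at hsum
    refine ⟨⟨⟨a.sum, by omega⟩, ⟨a, fun {i} hi => ?_, rfl⟩, ⟨b, fun {i} hi => ?_, ?_⟩⟩, rfl⟩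
    · exact hs (i, 1) (Multiset.mem_add.2 (.inl (Multiset.mem_map_of_mem _ hi)))
    · exact hs (i, -1) (Multiset.mem_add.2 (.inr (Multiset.mem_map_of_mem _ hi)))
    · dsimp only
      omega

/-- For every `n ≥ 1`, the number of conjugacy classes of `W(Bₙ)` equals the
number of bipartitions of `n`, i.e. `Σ_{k=0}^{n} p(k)·p(n-k)`. -/
theorem stmt_4 (n : ℕ) (hn : 1 ≤ n) :
    Nat.card (ConjClasses (BMat n).Group) =
      ∑ k ∈ Finset.range (n + 1),
        Fintype.card (Nat.Partition k) * Fintype.card (Nat.Partition (n - k)) := by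
  obtain ⟨m, rfl⟩ : ∃ m, n = m + 1 := ⟨n - 1, by omega⟩
  have e := MulEquiv.ofBijective _ (Hyperoctahedral.ofCoxeter_bijective m)
  have hconj : Nat.card (ConjClasses (BMat (m + 1)).Group) =
      Nat.card (ConjClasses (Hyperoctahedral (m + 1))) := by
    refine Nat.card_congr (Quotient.congr e.toEquiv fun a b => ?_)
    change IsConj a b ↔ IsConj (e a) (e b)
    exact ⟨fun h => e.toMonoidHom.map_isConj h,
      fun h => by simpa using e.symm.toMonoidHom.map_isConj h⟩
  rw [hconj, card_conjClasses_hyperoctahedral,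
    ← Nat.card_congr (Equiv.ofBijective _ (bijective_signedCycleTypeOfBipartition (m + 1))),
    Nat.card_sigma, Finset.sum_range]
  simp [Nat.card_eq_fintype_card]
end

section
/- Let n ≥ 1 and define the Jucys–Murphy elements of W(B_n) by J_1 := s_0 and J_{i+1} := s_i J_i s_i for 1 ≤ i ≤ n−1, and set w_0 := J_1 J_2 ⋯ J_n. Then w_0 ≠ 1 and the center of W(B_n) equals {1, w_0}; in particular the center is a group of order 2. -/
namespace TypeB

/-- The defining relations of `W(Bₙ)` for a sequence `s`, of which only the first `n` terms
matter. -/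
structure Relations {G : Type*} [Group G] (n : ℕ) (s : ℕ → G) : Prop where
  sq : ∀ i < n, s i * s i = 1
  four : 1 < n → s 0 * s 1 * s 0 * s 1 = s 1 * s 0 * s 1 * s 0
  braid : ∀ i, 1 ≤ i → i + 1 < n → s i * s (i + 1) * s i = s (i + 1) * s i * s (i + 1)
  comm : ∀ i j, i + 2 ≤ j → j < n → Commute (s i) (s j)

/-- The Jucys–Murphy elements, indexed from `0`. -/
def jm {G : Type*} [Group G] (s : ℕ → G) : ℕ → G
  | 0 => s 0
  | i + 1 => s (i + 1) * jm s i * s (i + 1)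

/-- The subgroup generated by the first `k` Jucys–Murphy elements. -/
def jmSubgroup {G : Type*} [Group G] (s : ℕ → G) (k : ℕ) : Subgroup G :=
  Subgroup.closure (jm s '' Set.Iio k)

/-- The subgroup generated by `s 1, …, s k`. -/
def symSubgroup {G : Type*} [Group G] (s : ℕ → G) (k : ℕ) : Subgroup G :=
  Subgroup.closure (s '' Set.Icc 1 k)

/-- The permutation of indices induced by the `i`-th generator. -/
def indexPerm : ℕ → Equiv.Perm ℕ
  | 0 => 1
  | i + 1 => Equiv.swap i (i + 1)

/-- The signed permutation induced by the `i`-th generator; the Boolean is the sign. -/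
def signedPerm : ℕ → Equiv.Perm (Bool × ℕ)
  | 0 => Equiv.swap (false, 0) (true, 0)
  | i + 1 => Equiv.prodCongr (Equiv.refl Bool) (Equiv.swap i (i + 1))

lemma relations_indexPerm (n : ℕ) : Relations n indexPerm where
  sq i _ := by cases i <;> simp [indexPerm]
  four _ := by simp [indexPerm]
  braid i hi _ := by
    obtain ⟨i, rfl⟩ := Nat.exists_eq_add_of_le' hi
    ext x
    simp only [indexPerm, Equiv.Perm.mul_apply, Equiv.swap_apply_def]
    grind
  comm i j hij _ := by
    obtain ⟨j, rfl⟩ := Nat.exists_eq_add_of_le' (show 1 ≤ j by omega)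
    cases i with
    | zero => exact Commute.one_left _
    | succ i =>
      ext x
      simp only [indexPerm, Equiv.Perm.mul_apply, Equiv.swap_apply_def]
      grind

lemma signedPerm_zero_apply (x : Bool × ℕ) :
    signedPerm 0 x = if x.2 = 0 then (!x.1, x.2) else x := by
  obtain ⟨b, j⟩ := x
  cases b <;> simp [signedPerm, Equiv.swap_apply_def] <;> grind

lemma signedPerm_succ_apply (i : ℕ) (x : Bool × ℕ) :
    signedPerm (i + 1) x = (x.1, if x.2 = i then i + 1 else if x.2 = i + 1 then i else x.2) := by
  simp [signedPerm, Equiv.swap_apply_def, Prod.map]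

lemma relations_signedPerm (n : ℕ) : Relations n signedPerm where
  sq i _ := by
    cases i with
    | zero => simp [signedPerm]
    | succ i =>
      ext1 x
      simp only [signedPerm_succ_apply, Equiv.Perm.mul_apply, Equiv.Perm.one_apply]
      grind
  four _ := by
    ext1 x
    simp only [signedPerm_zero_apply, signedPerm_succ_apply 0, Equiv.Perm.mul_apply]
    grind
  braid i hi _ := by
    obtain ⟨i, rfl⟩ := Nat.exists_eq_add_of_le' hi
    ext1 x
    simp only [signedPerm_succ_apply, Equiv.Perm.mul_apply]
    grind
  comm i j hij _ := by
    obtain ⟨j, rfl⟩ := Nat.exists_eq_add_of_le' (show 1 ≤ j by omega)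
    cases i with
    | zero =>
      ext1 x
      simp only [signedPerm_zero_apply, signedPerm_succ_apply, Equiv.Perm.mul_apply]
      grind
    | succ i =>
      ext1 x
      simp only [signedPerm_succ_apply, Equiv.Perm.mul_apply]
      grind

section Abstract

variable {G : Type*} [Group G] {n : ℕ} {s : ℕ → G}

lemma Relations.inv_eq (h : Relations n s) {i : ℕ} (hi : i < n) : (s i)⁻¹ = s i :=
  inv_eq_of_mul_eq_one_left (h.sq i hi)

lemma Relations.cancel_left (h : Relations n s) {i : ℕ} (hi : i < n) (x : G) :
    s i * (s i * x) = x := by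
  rw [← mul_assoc, h.sq i hi, one_mul]

lemma Relations.commute_jm_of_lt (h : Relations n s) {j k : ℕ} (hjk : j + 2 ≤ k) (hk : k < n) :
    Commute (s k) (jm s j) := by
  induction j with
  | zero => exact (h.comm 0 k hjk hk).symm
  | succ j ih =>
    have hc := (h.comm (j + 1) k hjk hk).symm
    exact (hc.mul_right (ih (by omega))).mul_right hc

lemma Relations.simple_mul_jm (h : Relations n s) {j : ℕ} (hj : j + 1 < n) :
    s (j + 1) * jm s j = jm s (j + 1) * s (j + 1) := by
  simp only [jm, mul_assoc, h.sq _ hj, mul_one]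

lemma Relations.commute_jm_of_gt (h : Relations n s) {j k : ℕ} (hk : 1 ≤ k) (hkj : k < j)
    (hj : j < n) : Commute (s k) (jm s j) := by
  induction j with
  | zero => omega
  | succ j ih =>
    rcases (show k = j ∨ k < j by omega) with rfl | hlt
    · obtain ⟨k, rfl⟩ := Nat.exists_eq_add_of_le' hk
      have hb := h.braid (k + 1) hk hj
      have hc := (h.commute_jm_of_lt (j := k) (le_refl _) hj).eq
      simp only [jm, Commute, SemiconjBy]
      calc s (k + 1) * (s (k + 1 + 1) * (s (k + 1) * jm s k * s (k + 1)) * s (k + 1 + 1))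
          = (s (k + 1) * s (k + 1 + 1) * s (k + 1)) * jm s k * s (k + 1) * s (k + 1 + 1) := by
            group
        _ = s (k + 1 + 1) * s (k + 1) * (s (k + 1 + 1) * jm s k) * s (k + 1) * s (k + 1 + 1) := by
            rw [hb]; group
        _ = s (k + 1 + 1) * s (k + 1) * jm s k * (s (k + 1 + 1) * s (k + 1) * s (k + 1 + 1)) := by
            rw [hc]; group
        _ = _ := by rw [← hb]; group
    · have hc := h.comm k (j + 1) (by omega) hj
      exact (hc.mul_right (ih hlt (by omega))).mul_right hc

lemma Relations.commute_zero_jm (h : Relations n s) {j : ℕ} (hj : j < n) :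
    Commute (s 0) (jm s j) := by
  induction j with
  | zero => exact Commute.refl _
  | succ j ih =>
    cases j with
    | zero =>
      have := h.four hj
      simp only [jm, Commute, SemiconjBy]
      simpa only [mul_assoc] using this
    | succ j =>
      have hc := h.comm 0 (j + 2) (by omega) hj
      exact (hc.mul_right (ih (by omega))).mul_right hc

lemma indexPerm_lt {i j : ℕ} (hi : i < n) (hj : j < n) : indexPerm i j < n := by
  cases i with
  | zero => exact hj
  | succ i => simp only [indexPerm, Equiv.swap_apply_def]; grind

lemma Relations.simple_mul_jm_eq (h : Relations n s) {i j : ℕ} (hi : i < n) (hj : j < n) :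
    s i * jm s j = jm s (indexPerm i j) * s i := by
  cases i with
  | zero => exact (h.commute_zero_jm hj).eq
  | succ i =>
    simp only [indexPerm, Equiv.swap_apply_def]
    split_ifs with h₁ h₂
    · subst h₁; exact h.simple_mul_jm hi
    · subst h₂
      simp only [jm, mul_assoc, h.cancel_left hi]
    · rcases lt_or_ge (i + 1) j with hlt | hge
      · exact (h.commute_jm_of_gt (by omega) hlt hj).eq
      · exact (h.commute_jm_of_lt (by omega) hi).eq

lemma Relations.jm_mul_self (h : Relations n s) {j : ℕ} (hj : j < n) : jm s j * jm s j = 1 := by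
  induction j with
  | zero => exact h.sq 0 hj
  | succ j ih =>
    have ih := ih (by omega)
    simp only [jm, mul_assoc, h.cancel_left hj]
    rw [← mul_assoc (jm s j), ih, one_mul, h.sq _ hj]

lemma Relations.jm_commute (h : Relations n s) {i j : ℕ} (hi : i < n) (hj : j < n) :
    Commute (jm s i) (jm s j) := by
  induction i generalizing j with
  | zero => exact h.commute_zero_jm hj
  | succ i ih =>
    have hc := (ih (by omega) (indexPerm_lt hi hj)).eq
    have hs := h.simple_mul_jm_eq hi hj
    have hs' := h.simple_mul_jm_eq hi (indexPerm_lt hi hj)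
    have hinv : indexPerm (i + 1) (indexPerm (i + 1) j) = j := Equiv.swap_apply_self _ _ _
    rw [hinv] at hs'
    simp only [jm, Commute, SemiconjBy, mul_assoc]
    rw [hs, ← mul_assoc (jm s i), hc, ← mul_assoc (s (i + 1)), ← mul_assoc (s (i + 1)), hs']
    simp only [mul_assoc]

lemma jm_mem_jmSubgroup {j k : ℕ} (hjk : j < k) : jm s j ∈ jmSubgroup s k :=
  Subgroup.subset_closure ⟨j, hjk, rfl⟩

lemma Relations.commute_of_mem_jmSubgroup (h : Relations n s) {x : G} (hx : x ∈ jmSubgroup s n)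
    {j : ℕ} (hj : j < n) : Commute x (jm s j) := by
  induction hx using Subgroup.closure_induction with
  | mem x hx => obtain ⟨i, hi, rfl⟩ := hx; exact h.jm_commute hi hj
  | one => exact Commute.one_left _
  | mul x y _ _ hx hy => exact hx.mul_left hy
  | inv x _ hx => exact hx.inv_left

lemma Relations.conj_jm (h : Relations n s) (hgen : Subgroup.closure (s '' Set.Iio n) = ⊤)
    (ρ : G →* Equiv.Perm ℕ) (hρ : ∀ i < n, ρ (s i) = indexPerm i) (w : G) {j : ℕ} (hj : j < n) :
    ρ w j < n ∧ w * jm s j = jm s (ρ w j) * w := by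
  have hw : w ∈ Subgroup.closure (s '' Set.Iio n) := hgen ▸ Subgroup.mem_top w
  induction hw using Subgroup.closure_induction_left generalizing j with
  | one => simp [hj]
  | mul_left x hx y _ ih =>
    obtain ⟨i, hi, rfl⟩ := hx
    obtain ⟨hlt, heq⟩ := ih hj
    rw [map_mul, hρ i hi, Equiv.Perm.mul_apply]
    exact ⟨indexPerm_lt hi hlt, by
      rw [mul_assoc, heq, ← mul_assoc, h.simple_mul_jm_eq hi hlt, mul_assoc]⟩
  | inv_mul_cancel x hx y _ ih =>
    obtain ⟨i, hi, rfl⟩ := hx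
    obtain ⟨hlt, heq⟩ := ih hj
    rw [h.inv_eq hi, map_mul, hρ i hi, Equiv.Perm.mul_apply]
    exact ⟨indexPerm_lt hi hlt, by
      rw [mul_assoc, heq, ← mul_assoc, h.simple_mul_jm_eq hi hlt, mul_assoc]⟩

lemma Relations.jmSubgroup_normal (h : Relations n s)
    (hgen : Subgroup.closure (s '' Set.Iio n) = ⊤)
    (ρ : G →* Equiv.Perm ℕ) (hρ : ∀ i < n, ρ (s i) = indexPerm i) :
    (jmSubgroup s n).Normal := by
  refine ⟨fun x hx w => ?_⟩
  induction hx using Subgroup.closure_induction with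
  | mem x hx =>
    obtain ⟨j, hj, rfl⟩ := hx
    obtain ⟨hlt, heq⟩ := h.conj_jm hgen ρ hρ w hj
    rw [heq, mul_inv_cancel_right]
    exact jm_mem_jmSubgroup hlt
  | one => simp
  | mul x y _ _ hx hy => simpa [mul_assoc] using mul_mem hx hy
  | inv x _ hx => simpa [mul_assoc] using inv_mem hx

lemma Relations.mem_jmSubgroup_succ (h : Relations n s) {k : ℕ} (hk : k < n) {x : G}
    (hx : x ∈ jmSubgroup s (k + 1)) :
    x ∈ jmSubgroup s k ∨ ∃ u ∈ jmSubgroup s k, x = jm s k * u := by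
  have step : ∀ j < k + 1, ∀ y, (y ∈ jmSubgroup s k ∨ ∃ u ∈ jmSubgroup s k, y = jm s k * u) →
      (jm s j * y ∈ jmSubgroup s k ∨ ∃ u ∈ jmSubgroup s k, jm s j * y = jm s k * u) := by
    intro j hj y hy
    rcases (show j = k ∨ j < k by omega) with rfl | hlt
    · rcases hy with hy | ⟨u, hu, rfl⟩
      · exact Or.inr ⟨y, hy, rfl⟩
      · left
        rwa [← mul_assoc, h.jm_mul_self hk, one_mul]
    · have hmem := jm_mem_jmSubgroup (s := s) hlt
      rcases hy with hy | ⟨u, hu, rfl⟩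
      · exact Or.inl (mul_mem hmem hy)
      · refine Or.inr ⟨jm s j * u, mul_mem hmem hu, ?_⟩
        rw [← mul_assoc, (h.jm_commute (by omega) hk).eq, mul_assoc]
  induction hx using Subgroup.closure_induction_left with
  | one => exact Or.inl (one_mem _)
  | mul_left x hx y _ ih => obtain ⟨j, hj, rfl⟩ := hx; exact step j hj y ih
  | inv_mul_cancel x hx y _ ih =>
    obtain ⟨j, hj, rfl⟩ := hx
    have hj' : j < k + 1 := hj
    rw [inv_eq_of_mul_eq_one_left (h.jm_mul_self (show j < n by omega))]
    exact step j hj y ih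

lemma map_jm_apply (φ : G →* Equiv.Perm (Bool × ℕ)) (hφ : ∀ i < n, φ (s i) = signedPerm i)
    {j : ℕ} (hj : j < n) (x : Bool × ℕ) :
    φ (jm s j) x = if x.2 = j then (!x.1, x.2) else x := by
  induction j generalizing x with
  | zero => rw [jm, hφ 0 hj, signedPerm_zero_apply]
  | succ j ih =>
    have ih := ih (by omega)
    simp only [jm, map_mul, hφ _ hj, Equiv.Perm.mul_apply, ih, signedPerm_succ_apply]
    grind

lemma map_apply_of_mem_jmSubgroup (φ : G →* Equiv.Perm (Bool × ℕ))
    (hφ : ∀ i < n, φ (s i) = signedPerm i) {k : ℕ} (hk : k ≤ n) {x : G}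
    (hx : x ∈ jmSubgroup s k) :
    ∀ b j, (φ x (b, j)).2 = j ∧ (k ≤ j → φ x (b, j) = (b, j)) := by
  induction hx using Subgroup.closure_induction with
  | mem x hx =>
    obtain ⟨i, hi, rfl⟩ := hx
    have hi' : i < k := hi
    intro b j
    rw [map_jm_apply φ hφ (by omega)]
    grind
  | one => simp
  | mul x y _ _ hx hy =>
    intro b j
    rw [map_mul, Equiv.Perm.mul_apply]
    have h₁ := hy b j
    have h₂ := hx (φ y (b, j)).1 j
    have h₃ : φ y (b, j) = ((φ y (b, j)).1, j) := Prod.ext rfl h₁.1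
    rw [← h₃] at h₂
    exact ⟨h₂.1, fun hkj => by rw [h₁.2 hkj, (hx b j).2 hkj]⟩
  | inv x _ hx =>
    intro b j
    have h₀ := (hx (φ x⁻¹ (b, j)).1 (φ x⁻¹ (b, j)).2).1
    rw [Prod.mk.eta, ← Equiv.Perm.mul_apply, ← map_mul, mul_inv_cancel, map_one,
      Equiv.Perm.one_apply, map_inv] at h₀
    rw [map_inv]
    exact ⟨h₀.symm, fun hkj => Equiv.Perm.inv_eq_iff_eq.2 ((hx b j).2 hkj).symm⟩

lemma Relations.eq_one_of_mem_jmSubgroup (h : Relations n s) (φ : G →* Equiv.Perm (Bool × ℕ))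
    (hφ : ∀ i < n, φ (s i) = signedPerm i) {k : ℕ} (hk : k ≤ n) {x : G}
    (hx : x ∈ jmSubgroup s k) (hfix : ∀ j < k, φ x (false, j) = (false, j)) : x = 1 := by
  induction k with
  | zero => simpa [jmSubgroup] using hx
  | succ k ih =>
    rcases h.mem_jmSubgroup_succ hk hx with hx | ⟨u, hu, rfl⟩
    · exact ih (by omega) hx fun j hj => hfix j (by omega)
    · have h₁ := hfix k (by omega)
      rw [map_mul, Equiv.Perm.mul_apply,
        (map_apply_of_mem_jmSubgroup φ hφ (by omega) hu false k).2 le_rfl,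
        map_jm_apply φ hφ hk] at h₁
      simp at h₁

/-- The product `s (j + 1) ⋯ s (j + d)`. -/
def ascending (s : ℕ → G) : ℕ → ℕ → G
  | _, 0 => 1
  | j, d + 1 => s (j + 1) * ascending s (j + 1) d

lemma Relations.commute_ascending (h : Relations n s) {i j d : ℕ} (hij : i < j)
    (hn : j + d < n) : Commute (s i) (ascending s j d) := by
  induction d generalizing j with
  | zero => exact Commute.one_right _
  | succ d ih =>
    exact (h.comm i (j + 1) (by omega) (by omega)).mul_right (ih (by omega) (by omega))

lemma Relations.simple_mul_ascending (h : Relations n s) {i j d : ℕ} (hij : j + 1 ≤ i)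
    (hid : i + 1 ≤ j + d) (hn : j + d < n) :
    s (i + 1) * ascending s j d = ascending s j d * s i := by
  induction d generalizing j with
  | zero => omega
  | succ d ih =>
    rcases (show i = j + 1 ∨ j + 2 ≤ i by omega) with rfl | hlt
    · cases d with
      | zero => omega
      | succ d =>
        have hb := h.braid (j + 1) (by omega) (by omega)
        have hc := (h.commute_ascending (i := j + 1) (j := j + 1 + 1) (d := d)
          (by omega) (by omega)).eq
        simp only [ascending, mul_assoc] at hb ⊢
        rw [← hc]
        simp only [← mul_assoc] at hb ⊢
        rw [hb]
    · have hc := (h.comm (j + 1) (i + 1) (by omega) (by omega)).eq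
      simp only [ascending]
      rw [← mul_assoc, ← hc, mul_assoc, ih (by omega) (by omega) (by omega), mul_assoc]

lemma simple_mem_symSubgroup {i k : ℕ} (hi : 1 ≤ i) (hik : i ≤ k) : s i ∈ symSubgroup s k :=
  Subgroup.subset_closure ⟨i, ⟨hi, hik⟩, rfl⟩

lemma Relations.mem_symSubgroup_succ (h : Relations n s) {k : ℕ} (hk : k + 1 < n) {x : G}
    (hx : x ∈ symSubgroup s (k + 1)) :
    ∃ j d, j + d = k + 1 ∧ ∃ u ∈ symSubgroup s k, x = ascending s j d * u := by
  have step : ∀ i, 1 ≤ i → i ≤ k + 1 → ∀ y,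
      (∃ j d, j + d = k + 1 ∧ ∃ u ∈ symSubgroup s k, y = ascending s j d * u) →
      ∃ j d, j + d = k + 1 ∧ ∃ u ∈ symSubgroup s k, s i * y = ascending s j d * u := by
    rintro i hi hik y ⟨j, d, hjd, u, hu, rfl⟩
    rcases lt_trichotomy i j with hlt | rfl | hgt
    · refine ⟨j, d, hjd, s i * u, mul_mem (simple_mem_symSubgroup hi (by omega)) hu, ?_⟩
      rw [← mul_assoc, (h.commute_ascending hlt (by omega)).eq, mul_assoc]
    · obtain ⟨i, rfl⟩ := Nat.exists_eq_add_of_le' hi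
      exact ⟨i, d + 1, by omega, u, hu, by simp only [ascending, mul_assoc]⟩
    · rcases (show i = j + 1 ∨ j + 2 ≤ i by omega) with rfl | hgt'
      · cases d with
        | zero => omega
        | succ d =>
          refine ⟨j + 1, d, by omega, u, hu, ?_⟩
          simp only [ascending, mul_assoc, h.cancel_left (show j + 1 < n by omega)]
      · obtain ⟨i, rfl⟩ := Nat.exists_eq_add_of_le' hi
        refine ⟨j, d, hjd, s i * u,
          mul_mem (simple_mem_symSubgroup (by omega) (by omega)) hu, ?_⟩
        rw [← mul_assoc, h.simple_mul_ascending (by omega) (by omega) (by omega), mul_assoc]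
  induction hx using Subgroup.closure_induction_left with
  | one => exact ⟨k + 1, 0, rfl, 1, one_mem _, by simp [ascending]⟩
  | mul_left x hx y _ ih => obtain ⟨i, hi, rfl⟩ := hx; exact step i hi.1 hi.2 y ih
  | inv_mul_cancel x hx y _ ih =>
    obtain ⟨i, hi, rfl⟩ := hx
    rw [h.inv_eq (hi.2.trans_lt hk)]
    exact step i hi.1 hi.2 y ih

lemma map_ascending_apply (ρ : G →* Equiv.Perm ℕ) (hρ : ∀ i < n, ρ (s i) = indexPerm i)
    {j d : ℕ} (hn : j + d < n) : ρ (ascending s j d) (j + d) = j := by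
  induction d generalizing j with
  | zero => simp [ascending]
  | succ d ih =>
    rw [ascending, map_mul, Equiv.Perm.mul_apply, show j + (d + 1) = j + 1 + d by omega,
      ih (by omega), hρ _ (by omega), indexPerm, Equiv.swap_apply_right]

lemma map_apply_of_mem_symSubgroup (ρ : G →* Equiv.Perm ℕ)
    (hρ : ∀ i < n, ρ (s i) = indexPerm i) {k : ℕ} (hk : k < n) {x : G}
    (hx : x ∈ symSubgroup s k) : ρ x (k + 1) = k + 1 := by
  induction hx using Subgroup.closure_induction with
  | mem x hx =>
    obtain ⟨i, ⟨hi, hik⟩, rfl⟩ := hx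
    obtain ⟨i, rfl⟩ := Nat.exists_eq_add_of_le' hi
    rw [hρ _ (by omega), indexPerm, Equiv.swap_apply_of_ne_of_ne (by omega) (by omega)]
  | one => simp
  | mul x y _ _ hx hy => rw [map_mul, Equiv.Perm.mul_apply, hy, hx]
  | inv x _ hx => rw [map_inv]; exact Equiv.Perm.inv_eq_iff_eq.2 hx.symm

lemma Relations.eq_one_of_mem_symSubgroup (h : Relations n s) (ρ : G →* Equiv.Perm ℕ)
    (hρ : ∀ i < n, ρ (s i) = indexPerm i) {k : ℕ} (hk : k < n) {x : G}
    (hx : x ∈ symSubgroup s k) (hfix : ∀ j < n, ρ x j = j) : x = 1 := by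
  induction k generalizing x with
  | zero => simpa [symSubgroup] using hx
  | succ k ih =>
    obtain ⟨j, d, hjd, u, hu, rfl⟩ := h.mem_symSubgroup_succ hk hx
    have h₁ := hfix (k + 1) hk
    rw [map_mul, Equiv.Perm.mul_apply, map_apply_of_mem_symSubgroup ρ hρ (by omega) hu,
      ← hjd, map_ascending_apply ρ hρ (by omega)] at h₁
    obtain rfl : d = 0 := by omega
    rw [ascending, one_mul] at hfix ⊢
    exact ih (by omega) hu hfix

lemma map_prod_jm_apply (φ : G →* Equiv.Perm (Bool × ℕ)) (hφ : ∀ i < n, φ (s i) = signedPerm i)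
    {k : ℕ} (hk : k ≤ n) (x : Bool × ℕ) :
    φ ((List.range k).map (jm s)).prod x = if x.2 < k then (!x.1, x.2) else x := by
  induction k generalizing x with
  | zero => simp
  | succ k ih =>
    rw [List.range_succ, List.map_append, List.prod_append, map_mul, Equiv.Perm.mul_apply,
      ih (by omega), List.map_singleton, List.prod_singleton, map_jm_apply φ hφ hk]
    grind

lemma prod_jm_mem_jmSubgroup (k : ℕ) : ((List.range k).map (jm s)).prod ∈ jmSubgroup s k := by
  refine list_prod_mem fun x hx => ?_
  obtain ⟨j, hj, rfl⟩ := List.mem_map.1 hx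
  exact jm_mem_jmSubgroup (List.mem_range.1 hj)

lemma Relations.eq_of_mem_jmSubgroup (h : Relations n s) (φ : G →* Equiv.Perm (Bool × ℕ))
    (hφ : ∀ i < n, φ (s i) = signedPerm i) {x y : G} (hx : x ∈ jmSubgroup s n)
    (hy : y ∈ jmSubgroup s n) (hxy : φ x = φ y) : x = y :=
  mul_inv_eq_one.1 <| h.eq_one_of_mem_jmSubgroup φ hφ le_rfl (mul_mem hx (inv_mem hy)) (by
    simp [hxy])

lemma Relations.prod_jm_mem_center (h : Relations n s)
    (hgen : Subgroup.closure (s '' Set.Iio n) = ⊤)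
    (ρ : G →* Equiv.Perm ℕ) (hρ : ∀ i < n, ρ (s i) = indexPerm i)
    (φ : G →* Equiv.Perm (Bool × ℕ)) (hφ : ∀ i < n, φ (s i) = signedPerm i) :
    ((List.range n).map (jm s)).prod ∈ Subgroup.center G := by
  have hN := h.jmSubgroup_normal hgen ρ hρ
  set w := ((List.range n).map (jm s)).prod with hw
  have hmem : w ∈ jmSubgroup s n := prod_jm_mem_jmSubgroup n
  have hle : Subgroup.closure (s '' Set.Iio n) ≤ Subgroup.centralizer {w} := by
    rw [Subgroup.closure_le]
    rintro _ ⟨i, hi, rfl⟩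
    have hi' : i < n := hi
    rw [SetLike.mem_coe, Subgroup.mem_centralizer_singleton_iff]
    refine mul_inv_eq_iff_eq_mul.1 (h.eq_of_mem_jmSubgroup φ hφ (hN.conj_mem w hmem _) hmem ?_)
    rw [map_mul, map_mul, map_inv, mul_inv_eq_iff_eq_mul, hφ i hi']
    ext1 x
    rw [Equiv.Perm.mul_apply, Equiv.Perm.mul_apply, hw, map_prod_jm_apply φ hφ le_rfl,
      map_prod_jm_apply φ hφ le_rfl]
    cases i with
    | zero => simp only [signedPerm_zero_apply]; grind
    | succ i => simp only [signedPerm_succ_apply]; grind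
  rw [hgen] at hle
  refine Subgroup.mem_center_iff.2 fun g => ?_
  exact Subgroup.mem_centralizer_singleton_iff.1 (hle (Subgroup.mem_top g))

lemma Relations.mem_jmSubgroup_of_mem_center (h : Relations n s) (hn : 1 ≤ n)
    (hgen : Subgroup.closure (s '' Set.Iio n) = ⊤)
    (ρ : G →* Equiv.Perm ℕ) (hρ : ∀ i < n, ρ (s i) = indexPerm i)
    (φ : G →* Equiv.Perm (Bool × ℕ)) (hφ : ∀ i < n, φ (s i) = signedPerm i)
    {w : G} (hw : w ∈ Subgroup.center G) : w ∈ jmSubgroup s n := by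
  have hN := h.jmSubgroup_normal hgen ρ hρ
  have htop : jmSubgroup s n ⊔ symSubgroup s (n - 1) = ⊤ := by
    rw [eq_top_iff, ← hgen, Subgroup.closure_le]
    rintro _ ⟨i, hi, rfl⟩
    have hi' : i < n := hi
    cases i with
    | zero => exact (le_sup_left : jmSubgroup s n ≤ _) (jm_mem_jmSubgroup (j := 0) hi')
    | succ i =>
      exact (le_sup_right : symSubgroup s (n - 1) ≤ _)
        (simple_mem_symSubgroup (by omega) (by omega))
  obtain ⟨ε, hε, π, hπ, rfl⟩ := Subgroup.mem_sup_of_normal_left.1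
    (htop ▸ Subgroup.mem_top w : w ∈ jmSubgroup s n ⊔ symSubgroup s (n - 1))
  suffices hone : π = 1 by rwa [hone, mul_one]
  refine h.eq_one_of_mem_symSubgroup ρ hρ (by omega) hπ fun j hj => ?_
  have hwJ : Commute (ε * π) (jm s j) := (Subgroup.mem_center_iff.1 hw _).symm
  have hπJ : Commute π (jm s j) := by
    simpa using (h.commute_of_mem_jmSubgroup hε hj).inv_left.mul_left hwJ
  obtain ⟨hlt, heq⟩ := h.conj_jm hgen ρ hρ π hj
  have hJ : jm s j = jm s (ρ π j) := mul_right_cancel (hπJ.eq.symm.trans heq)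
  have h₁ := map_jm_apply φ hφ hj (false, j)
  rw [hJ, map_jm_apply φ hφ hlt] at h₁
  by_contra hne
  simp [Ne.symm hne] at h₁

lemma Relations.eq_one_of_mem_center (h : Relations n s) (hn : 1 ≤ n)
    (hgen : Subgroup.closure (s '' Set.Iio n) = ⊤)
    (ρ : G →* Equiv.Perm ℕ) (hρ : ∀ i < n, ρ (s i) = indexPerm i)
    (φ : G →* Equiv.Perm (Bool × ℕ)) (hφ : ∀ i < n, φ (s i) = signedPerm i)
    {w : G} (hw : w ∈ Subgroup.center G) (hfix : φ w (false, 0) = (false, 0)) : w = 1 := by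
  refine h.eq_one_of_mem_jmSubgroup φ hφ le_rfl
    (h.mem_jmSubgroup_of_mem_center hn hgen ρ hρ φ hφ hw) fun j hj => ?_
  induction j with
  | zero => exact hfix
  | succ j ih =>
    have hmove : signedPerm (j + 1) (false, j) = (false, j + 1) := by
      simp [signedPerm_succ_apply]
    have hc := congrArg φ (Subgroup.mem_center_iff.1 hw (s (j + 1)))
    rw [map_mul, map_mul, hφ _ hj] at hc
    have hc := Equiv.congr_fun hc (false, j)
    rw [Equiv.Perm.mul_apply, Equiv.Perm.mul_apply, ih (by omega), hmove] at hc
    exact hc.symm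

lemma Relations.mem_center_iff (h : Relations n s) (hn : 1 ≤ n)
    (hgen : Subgroup.closure (s '' Set.Iio n) = ⊤)
    (ρ : G →* Equiv.Perm ℕ) (hρ : ∀ i < n, ρ (s i) = indexPerm i)
    (φ : G →* Equiv.Perm (Bool × ℕ)) (hφ : ∀ i < n, φ (s i) = signedPerm i) {w : G} :
    w ∈ Subgroup.center G ↔ w = 1 ∨ w = ((List.range n).map (jm s)).prod := by
  have hw₀ := h.prod_jm_mem_center hgen ρ hρ φ hφ
  refine ⟨fun hw => ?_, ?_⟩
  · have hN := h.mem_jmSubgroup_of_mem_center hn hgen ρ hρ φ hφ hw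
    have hidx := (map_apply_of_mem_jmSubgroup φ hφ le_rfl hN false 0).1
    cases hb : (φ w (false, 0)).1 with
    | false =>
      exact Or.inl (h.eq_one_of_mem_center hn hgen ρ hρ φ hφ hw (Prod.ext hb hidx))
    | true =>
      right
      have hval : φ w (false, 0) = (true, 0) := Prod.ext hb hidx
      refine (inv_mul_eq_one.1 (h.eq_one_of_mem_center hn hgen ρ hρ φ hφ
        (mul_mem (inv_mem hw₀) hw) ?_)).symm
      rw [map_mul, map_inv, Equiv.Perm.mul_apply, hval, Equiv.Perm.inv_eq_iff_eq,
        map_prod_jm_apply φ hφ le_rfl]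
      simp [Nat.pos_of_ne_zero (show n ≠ 0 by omega)]
  · rintro (rfl | rfl)
    · exact one_mem _
    · exact hw₀

end Abstract

/-- The simple reflections of `W(Bₙ)`, extended by `1` to all natural numbers. -/
def simples (n : ℕ) (i : ℕ) : (BMat n).Group :=
  if h : i < n then (BMat n).simple ⟨i, h⟩ else 1

lemma simples_of_lt {n i : ℕ} (h : i < n) : simples n i = (BMat n).simple ⟨i, h⟩ := dif_pos h

lemma simples_mul_pow {n i j : ℕ} (hi : i < n) (hj : j < n) :
    (simples n i * simples n j) ^ (BMat n) ⟨i, hi⟩ ⟨j, hj⟩ = 1 := by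
  rw [simples_of_lt hi, simples_of_lt hj]
  exact (BMat n).toCoxeterSystem.simple_mul_simple_pow ⟨i, hi⟩ ⟨j, hj⟩

lemma simples_mul_self {n i : ℕ} (hi : i < n) : simples n i * simples n i = 1 := by
  simpa using simples_mul_pow hi hi

lemma simples_inv {n i : ℕ} (hi : i < n) : (simples n i)⁻¹ = simples n i :=
  inv_eq_of_mul_eq_one_left (simples_mul_self hi)

lemma BMat_apply_four {n : ℕ} (h : 1 < n) : (BMat n) ⟨0, by omega⟩ ⟨1, h⟩ = 4 := by
  simp [BMat]

lemma BMat_apply_three {n i : ℕ} (hi : 1 ≤ i) (h : i + 1 < n) :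
    (BMat n) ⟨i, by omega⟩ ⟨i + 1, h⟩ = 3 := by
  simp [BMat]; omega

lemma BMat_apply_two {n i j : ℕ} (hij : i + 2 ≤ j) (h : j < n) :
    (BMat n) ⟨i, by omega⟩ ⟨j, h⟩ = 2 := by
  simp [BMat]; grind

lemma relations_simples (n : ℕ) : Relations n (simples n) where
  sq i hi := simples_mul_self hi
  four hn := by
    have h := simples_mul_pow (show 0 < n by omega) hn
    rw [BMat_apply_four hn] at h
    have h' : (simples n 0 * simples n 1 * simples n 0 * simples n 1) *
        (simples n 0 * simples n 1 * simples n 0 * simples n 1) = 1 := by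
      simpa only [pow_succ, pow_zero, one_mul, mul_assoc] using h
    rw [eq_inv_of_mul_eq_one_left h']
    simp only [mul_inv_rev, simples_inv hn, simples_inv (show 0 < n by omega), mul_assoc]
  braid i hi hn := by
    have h := simples_mul_pow (show i < n by omega) hn
    rw [BMat_apply_three hi hn] at h
    have h' : (simples n i * simples n (i + 1) * simples n i) *
        (simples n (i + 1) * simples n i * simples n (i + 1)) = 1 := by
      simpa only [pow_succ, pow_zero, one_mul, mul_assoc] using h
    rw [eq_inv_of_mul_eq_one_left h']
    simp only [mul_inv_rev, simples_inv hn, simples_inv (show i < n by omega), mul_assoc]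
  comm i j hij hj := by
    have h := simples_mul_pow (show i < n by omega) hj
    rw [BMat_apply_two hij hj] at h
    have h' : (simples n i * simples n j) * (simples n i * simples n j) = 1 := by
      rwa [sq] at h
    rw [Commute, SemiconjBy, eq_inv_of_mul_eq_one_left h', mul_inv_rev, simples_inv hj,
      simples_inv (show i < n by omega)]

lemma closure_simples (n : ℕ) : Subgroup.closure (simples n '' Set.Iio n) = ⊤ := by
  rw [← (BMat n).toCoxeterSystem.subgroup_closure_range_simple]
  congr 1
  ext x
  constructor
  · rintro ⟨i, hi, rfl⟩
    exact ⟨⟨i, hi⟩, (simples_of_lt hi).symm⟩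
  · rintro ⟨i, rfl⟩
    exact ⟨i, i.2, simples_of_lt i.2⟩

lemma Relations.isLiftable {G : Type*} [Group G] {n : ℕ} {f : ℕ → G} (h : Relations n f) :
    (BMat n).IsLiftable fun i : Fin n => f i := by
  have hlt : ∀ i j : Fin n, i < j → (f i * f j) ^ (BMat n) i j = 1 := by
    rintro ⟨i, hi⟩ ⟨j, hj⟩ hij
    have hij : i < j := hij
    have hii := h.sq i hi
    have hjj := h.sq j hj
    rcases (show j = i + 1 ∨ i + 2 ≤ j by omega) with rfl | hij'
    · rcases Nat.eq_zero_or_pos i with rfl | hpos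
      · rw [BMat_apply_four hj]
        calc (f 0 * f 1) ^ 4 = (f 0 * f 1 * f 0 * f 1) * (f 0 * f 1 * f 0 * f 1) := by
              simp only [pow_succ, pow_zero, one_mul, mul_assoc]
          _ = (f 0 * f 1 * f 0 * f 1) * (f 0 * f 1 * f 0 * f 1)⁻¹ := by
              congr 1
              simp only [mul_inv_rev, h.inv_eq hi, h.inv_eq hj]
              simpa only [mul_assoc] using h.four hj
          _ = 1 := mul_inv_cancel _
      · rw [BMat_apply_three hpos hj]
        calc (f i * f (i + 1)) ^ 3 =
              (f i * f (i + 1) * f i) * (f (i + 1) * f i * f (i + 1)) := by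
              simp only [pow_succ, pow_zero, one_mul, mul_assoc]
          _ = (f i * f (i + 1) * f i) * (f i * f (i + 1) * f i)⁻¹ := by
              rw [← h.braid i hpos hj]
              simp only [mul_inv_rev, h.inv_eq hi, h.inv_eq hj, mul_assoc]
          _ = 1 := mul_inv_cancel _
    · rw [BMat_apply_two hij' hj, (h.comm i j hij' hj).mul_pow, pow_two, pow_two, hii, hjj, one_mul]
  intro i j
  rcases lt_trichotomy i j with hij | rfl | hij
  · exact hlt i j hij
  · simpa using h.sq i i.2
  · have hinv : f i * f j = (f j * f i)⁻¹ := by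
      rw [mul_inv_rev, h.inv_eq i.2, h.inv_eq j.2]
    rw [hinv, inv_pow, (BMat n).symmetric, hlt j i hij, inv_one]

lemma Relations.exists_lift {G : Type*} [Group G] {n : ℕ} {f : ℕ → G} (h : Relations n f) :
    ∃ φ : (BMat n).Group →* G, ∀ i < n, φ (simples n i) = f i :=
  ⟨(BMat n).toCoxeterSystem.lift ⟨_, h.isLiftable⟩, fun i hi => by
    rw [simples_of_lt hi]
    exact (BMat n).toCoxeterSystem.lift_apply_simple h.isLiftable ⟨i, hi⟩⟩

end TypeB

/-- Let `n ≥ 1` and let `J : ℕ → W(Bₙ)` with `J 0 = s₀` (the element `J_1`) and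
`J i = sᵢ · J (i-1) · sᵢ` for `1 ≤ i ≤ n-1` (so `J i` is the Jucys–Murphy element `J_{i+1}`),
and let `w₀ := J_1 J_2 ⋯ J_n` be their product. Then `w₀ ≠ 1`, the center of `W(Bₙ)` is exactly
`{1, w₀}`, and in particular the center has order `2`. -/
theorem stmt_5 (n : ℕ) (hn : 1 ≤ n) (J : ℕ → (BMat n).Group)
    (hJ0 : J 0 = (BMat n).simple ⟨0, by omega⟩)
    (hJ : ∀ i : Fin n, 1 ≤ (i : ℕ) →
      J (i : ℕ) = (BMat n).simple i * J ((i : ℕ) - 1) * (BMat n).simple i)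
    (w₀ : (BMat n).Group) (hw₀ : w₀ = ((List.range n).map J).prod) :
    w₀ ≠ 1 ∧
    (Subgroup.center (BMat n).Group : Set (BMat n).Group) = {1, w₀} ∧
    Nat.card (Subgroup.center (BMat n).Group) = 2 := by
  obtain ⟨ρ, hρ⟩ := (TypeB.relations_indexPerm n).exists_lift
  obtain ⟨φ, hφ⟩ := (TypeB.relations_signedPerm n).exists_lift
  have hJeq : ∀ i, i < n → J i = TypeB.jm (TypeB.simples n) i := by
    intro i
    induction i with
    | zero => intro hi; rw [hJ0, TypeB.jm, TypeB.simples_of_lt hi]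
    | succ i ih =>
      intro hi
      have hstep := hJ ⟨i + 1, hi⟩ (Nat.le_add_left 1 i)
      simp only [Nat.add_sub_cancel] at hstep
      rw [hstep, ih (by omega), TypeB.jm, TypeB.simples_of_lt hi]
  have hprod : w₀ = ((List.range n).map (TypeB.jm (TypeB.simples n))).prod := by
    rw [hw₀, List.map_congr_left fun i hi => hJeq i (List.mem_range.1 hi)]
  have hne : w₀ ≠ 1 := by
    intro hone
    have hflip := TypeB.map_prod_jm_apply φ hφ le_rfl (false, 0)
    rw [← hprod, hone] at hflip
    simp [Nat.pos_of_ne_zero (show n ≠ 0 by omega)] at hflip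
  have hcenter : (Subgroup.center (BMat n).Group : Set (BMat n).Group) = {1, w₀} := by
    ext w
    rw [SetLike.mem_coe, (TypeB.relations_simples n).mem_center_iff hn (TypeB.closure_simples n)
      ρ hρ φ hφ, ← hprod]
    rfl
  refine ⟨hne, hcenter, ?_⟩
  rw [← SetLike.coe_sort_coe, hcenter, Nat.card_coe_set_eq, Set.ncard_pair hne.symm]
end

section
/- Let n ≥ 0 and m ∈ ℤ, and set v_m := e_x + q^m·e_y and w_m := e_x − q^{−m}·e_y in W_1. If z ∈ W_n satisfies B_n z = [m]·z, then B_{n+1}(z ⊗ v_m) = [m+1]·(z ⊗ v_m) and B_{n+1}(z ⊗ w_m) = [m−1]·(z ⊗ w_m). -/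
set_option synthInstance.maxHeartbeats 1000000
set_option maxHeartbeats 1000000

noncomputable section

/-- The ground field `K = ℂ(q)`, the complex rational functions. -/
abbrev K : Type := RatFunc ℂ

/-- The variable `q ∈ K = ℂ(q)`. -/
noncomputable def q : K := RatFunc.X

/-- The quantum integer `[m] = (q^m - q^{-m})/(q - q⁻¹) ∈ K`, for `m : ℤ`. -/
noncomputable def qint (m : ℤ) : K := (q ^ m - q ^ (-m)) / (q - q⁻¹)

/-- `W n` is the `K`-vector space of functions `(Fin n → Bool) → K`, with standard basis
indexed by the words of length `n` in the letters `x` (encoded `false`) and `y` (encoded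
`true`); it models the tensor power `V^{⊗n}` of the standard representation of
`U_q(gl₂)`. -/
abbrev W (n : ℕ) : Type := (Fin n → Bool) → K

/-- `ε(x) = -1`, `ε(y) = 1`. -/
def eps (b : Bool) : ℤ := if b then 1 else -1

/-- The word `w` with its `i`-th letter flipped. -/
def flipLetter (n : ℕ) (w : Fin n → Bool) (i : Fin n) : Fin n → Bool :=
  Function.update w i (!(w i))

/-- The `K`-linear endomorphism `B` of `W n = V^{⊗n}` given on basis vectors by
`B e_w = Σ_{i=0}^{n-1} (Π_{j=i+1}^{n-1} q^{ε(w_j)}) e_{w⁽ⁱ⁾}`; it is the action on `V^{⊗n}`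
of the generator `B = q⁻¹EK⁻¹ + F` of the coideal subalgebra `U_q'(gl₁ × gl₁)` of
`U_q(gl₂)`. -/
noncomputable def Bop (n : ℕ) : Module.End K (W n) where
  toFun f := fun u => ∑ i : Fin n,
    (∏ j ∈ Finset.univ.filter (fun j => i < j), q ^ eps (u j)) * f (flipLetter n u i)
  map_add' f g := by
    funext u
    simp only [Pi.add_apply, mul_add]
    rw [Finset.sum_add_distrib]
  map_smul' c f := by
    funext u
    simp only [Pi.smul_apply, smul_eq_mul, RingHom.id_apply]
    rw [Finset.mul_sum]
    exact Finset.sum_congr rfl fun i _ => by ring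

/-- The concatenation product `W n × W 1 → W (n+1)`, modelling `z ⊗ v ∈ V^{⊗(n+1)}`;
on basis vectors, `e_w ⊗ e_a = e_{wa}`. -/
noncomputable def tensOne (n : ℕ) (z : W n) (v : W 1) : W (n + 1) :=
  fun u => z (fun i => u i.castSucc) * v (fun _ => u (Fin.last n))

/-- The vector `v_m = e_x + q^m e_y ∈ W 1 = V`. -/
noncomputable def vVec (m : ℤ) : W 1 := fun w => if w 0 then q ^ m else 1

/-- The vector `w_m = e_x - q^{-m} e_y ∈ W 1 = V`. -/
noncomputable def wVec (m : ℤ) : W 1 := fun w => if w 0 then -(q ^ (-m)) else 1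

theorem q_ne_zero : q ≠ 0 := RatFunc.X_ne_zero

theorem q_sub_inv_ne_zero : q - q⁻¹ ≠ 0 := by
  intro h
  have hsq : q ^ 2 = 1 := by
    have := congrArg (q * ·) h
    simp only [mul_sub, mul_inv_cancel₀ q_ne_zero, mul_zero] at this
    linear_combination this
  have hpoly : algebraMap (Polynomial ℂ) K (Polynomial.X ^ 2) =
      algebraMap (Polynomial ℂ) K 1 := by
    simpa [q, RatFunc.algebraMap_X] using hsq
  have := congrArg Polynomial.natDegree (RatFunc.algebraMap_injective ℂ hpoly)
  simp at this

theorem qint_add_one (m : ℤ) : qint (m + 1) = q⁻¹ * qint m + q ^ m := by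
  have hd := q_sub_inv_ne_zero
  rw [qint, qint, div_eq_iff hd, add_mul, mul_assoc, div_mul_cancel₀ _ hd, neg_add,
    zpow_add₀ q_ne_zero, zpow_add₀ q_ne_zero, zpow_one, zpow_neg_one]
  ring

theorem qint_add_one' (m : ℤ) : qint (m + 1) = q * qint m + q ^ (-m) := by
  have hd := q_sub_inv_ne_zero
  rw [qint, qint, div_eq_iff hd, add_mul, mul_assoc, div_mul_cancel₀ _ hd, neg_add,
    zpow_add₀ q_ne_zero, zpow_add₀ q_ne_zero, zpow_one, zpow_neg_one]
  ring

theorem qint_neg (m : ℤ) : qint (-m) = -qint m := by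
  rw [qint, qint, neg_neg, ← neg_div, neg_sub]

theorem qint_sub_one (m : ℤ) : qint (m - 1) = q⁻¹ * qint m - q ^ (-m) := by
  have h := qint_add_one (-m)
  rw [show -m + 1 = -(m - 1) by ring, qint_neg, qint_neg] at h
  linear_combination -h

theorem qint_sub_one' (m : ℤ) : qint (m - 1) = q * qint m - q ^ m := by
  have h := qint_add_one' (-m)
  rw [show -m + 1 = -(m - 1) by ring, qint_neg, qint_neg, neg_neg] at h
  linear_combination -h

/-- The coproduct rule for `B` acting on `z ⊗ v`, read off at the coordinate `u`. -/
theorem Bop_tensOne_apply (n : ℕ) (z : W n) (v : W 1) (u : Fin (n + 1) → Bool) :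
    Bop (n + 1) (tensOne n z v) u =
      q ^ eps (u (Fin.last n)) * Bop n z (fun i => u i.castSucc) *
          v (fun _ => u (Fin.last n)) +
        z (fun i => u i.castSucc) * v (fun _ => !(u (Fin.last n))) := by
  have hinit (i : Fin n) : (fun k : Fin n => flipLetter (n + 1) u i.castSucc k.castSucc) =
      flipLetter n (fun k => u k.castSucc) i := by
    funext k
    simp [flipLetter, Function.update_apply]
  have hlast (i : Fin n) : flipLetter (n + 1) u i.castSucc (Fin.last n) = u (Fin.last n) := by
    simp [flipLetter, (Fin.castSucc_lt_last i).ne']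
  have hinit_last : (fun k : Fin n => flipLetter (n + 1) u (Fin.last n) k.castSucc) =
      fun k => u k.castSucc := by
    funext k
    simp [flipLetter, (Fin.castSucc_lt_last k).ne]
  simp only [Bop, LinearMap.coe_mk, AddHom.coe_mk, tensOne, Finset.prod_filter]
  rw [Fin.sum_univ_castSucc, Finset.mul_sum, Finset.sum_mul]
  congr 1
  · refine Finset.sum_congr rfl fun i _ => ?_
    rw [Fin.prod_univ_castSucc, hinit, hlast, if_pos (Fin.castSucc_lt_last i)]
    simp only [Fin.castSucc_lt_castSucc_iff]
    ring
  · rw [hinit_last, Finset.prod_eq_one fun j _ => if_neg (Fin.le_last j).not_gt, one_mul]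
    simp [flipLetter]

/-- Let `n ≥ 0`, `m ∈ ℤ`, `v_m = e_x + q^m e_y` and `w_m = e_x - q^{-m} e_y`.
If `z ∈ W n` satisfies `B z = [m]·z`, then `B (z ⊗ v_m) = [m+1]·(z ⊗ v_m)` and
`B (z ⊗ w_m) = [m-1]·(z ⊗ w_m)`. -/
theorem stmt_6 (n : ℕ) (m : ℤ) (z : W n) (hz : Bop n z = qint m • z) :
    Bop (n + 1) (tensOne n z (vVec m)) = qint (m + 1) • tensOne n z (vVec m) ∧
    Bop (n + 1) (tensOne n z (wVec m)) = qint (m - 1) • tensOne n z (wVec m) := by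
  have hq (k : ℤ) : q ^ k * q ^ (-k) = 1 := by
    rw [← zpow_add₀ q_ne_zero, add_neg_cancel, zpow_zero]
  constructor <;> funext u <;>
    rw [Bop_tensOne_apply, hz] <;>
    cases hu : u (Fin.last n) <;>
    simp only [Pi.smul_apply, smul_eq_mul, tensOne, vVec, wVec, hu, eps, Bool.not_true,
      Bool.not_false, Bool.false_eq_true, if_true, if_false, zpow_one, zpow_neg_one]
  · rw [qint_add_one]
    ring
  · rw [qint_add_one']
    linear_combination -z (fun i => u i.castSucc) * hq m
  · rw [qint_sub_one]
    ring
  · rw [qint_sub_one']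
    linear_combination -z (fun i => u i.castSucc) * hq m
end
end

section
/- For every integer n ≥ 1 and every k ∈ {0, …, n}, the eigenspace of the endomorphism B_n of W_n for the eigenvalue [n−2k] has K-dimension (n choose k); moreover W_n is the internal direct sum of these n+1 eigenspaces, i.e. B_n is diagonalizable with eigenvalues exactly the quantum integers [n], [n−2], …, [−n]. -/
set_option synthInstance.maxHeartbeats 1000000
set_option maxHeartbeats 1000000

noncomputable section

theorem q_zpow_eq_one_iff {m : ℤ} : q ^ m = 1 ↔ m = 0 := by
  refine ⟨fun h => ?_, fun h => by simp [h]⟩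
  have hpow : ∀ k : ℕ, RatFunc.intDegree (q ^ k) = k := by
    intro k
    induction k with
    | zero => simp
    | succ k ih =>
      rw [pow_succ, RatFunc.intDegree_mul (pow_ne_zero _ q_ne_zero) q_ne_zero, ih, q,
        RatFunc.intDegree_X]
      push_cast
      rfl
  have hdeg : ∀ k : ℕ, q ^ k = 1 → k = 0 := by
    intro k hk
    have := hpow k
    rw [hk, RatFunc.intDegree_one] at this
    exact_mod_cast this.symm
  obtain ⟨k, rfl | rfl⟩ := m.eq_nat_or_neg
  · rw [zpow_natCast] at h
    simp [hdeg k h]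
  · rw [zpow_neg, zpow_natCast, inv_eq_one] at h
    simp [hdeg k h]

theorem q_zpow_ne_neg_one (m : ℤ) : q ^ m ≠ -1 := by
  intro h
  have h2 : q ^ (m + m) = 1 := by
    rw [zpow_add₀ q_ne_zero, h]
    ring
  obtain rfl : m = 0 := by
    have := q_zpow_eq_one_iff.mp h2
    omega
  have h3 : (1 : K) = -1 := by simpa using h
  exact self_ne_neg.mpr one_ne_zero h3

theorem q_zpow_injective : Function.Injective (fun m : ℤ => q ^ m) := by
  intro a b h
  have h1 : q ^ (a - b) = 1 := by
    rw [zpow_sub₀ q_ne_zero]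
    exact (div_eq_one_iff_eq (zpow_ne_zero _ q_ne_zero)).mpr h
  have := q_zpow_eq_one_iff.mp h1
  omega

theorem q_zpow_add_zpow_neg_ne_zero (m : ℤ) : q ^ m + q ^ (-m) ≠ 0 := by
  intro h
  apply q_zpow_ne_neg_one (m + m)
  have hm : q ^ m * q ^ (-m) = 1 := by
    rw [← zpow_add₀ q_ne_zero]
    simp
  rw [zpow_add₀ q_ne_zero]
  linear_combination q ^ m * h - hm

theorem qint_injective : Function.Injective qint := by
  intro a b h
  rw [qint, qint, div_left_inj' q_sub_inv_ne_zero] at h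
  have ha : q ^ a ≠ 0 := zpow_ne_zero _ q_ne_zero
  have hb : q ^ b ≠ 0 := zpow_ne_zero _ q_ne_zero
  have hfac : (q ^ a - q ^ b) * (q ^ (a + b) + 1) = 0 := by
    rw [zpow_add₀ q_ne_zero]
    rw [zpow_neg, zpow_neg] at h
    field_simp at h
    linear_combination h
  rcases mul_eq_zero.mp hfac with h1 | h1
  · exact q_zpow_injective (sub_eq_zero.mp h1)
  · exact absurd (eq_neg_of_add_eq_zero_left h1) (q_zpow_ne_neg_one _)

/-- The number of letters `x` minus the number of letters `y` in a word. -/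
def weight {n : ℕ} (w : Fin n → Bool) : ℤ := ∑ i, -eps (w i)

theorem weight_snoc {n : ℕ} (w : Fin n → Bool) (b : Bool) :
    weight (Fin.snoc w b : Fin (n + 1) → Bool) = weight w - eps b := by
  simp [weight, Fin.sum_univ_castSucc, sub_eq_add_neg, add_comm]

theorem weight_eq_sub_card {n : ℕ} (w : Fin n → Bool) :
    weight w = n - 2 * ((Finset.univ.filter fun i => w i = true).card : ℤ) := by
  have h : ∀ i, -eps (w i) = 1 - 2 * (if w i = true then 1 else 0) := by
    intro i
    cases w i <;> simp [eps]
  simp only [weight, h, Finset.sum_sub_distrib, ← Finset.mul_sum, Finset.sum_boole]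
  simp

theorem card_words_with_card_true (n k : ℕ) :
    (Finset.univ.filter fun w : Fin n → Bool =>
      (Finset.univ.filter fun i => w i = true).card = k).card = n.choose k := by
  rw [← Finset.card_fin n, ← Finset.card_powersetCard, Finset.card_fin]
  refine Finset.card_nbij' (fun w => Finset.univ.filter fun i => w i = true)
    (fun s i => decide (i ∈ s)) ?_ ?_ ?_ ?_
  · intro w hw
    simpa [Finset.mem_powersetCard] using hw
  · intro s hs
    simpa [Finset.mem_powersetCard] using hs
  · intro w _
    funext i
    simp
  · intro s _
    ext i
    simp

theorem Bop_apply {n : ℕ} (f : W n) (u : Fin n → Bool) :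
    Bop n f u = ∑ i : Fin n,
      (∏ j ∈ Finset.univ.filter (fun j => i < j), q ^ eps (u j)) * f (flipLetter n u i) :=
  rfl

/-- Splitting off the last tensor factor. -/
theorem Bop_snoc {n : ℕ} (f : W (n + 1)) (u : Fin n → Bool) (b : Bool) :
    Bop (n + 1) f (Fin.snoc u b) =
      q ^ eps b * Bop n (fun u' => f (Fin.snoc u' b)) u + f (Fin.snoc u (!b)) := by
  rw [Bop_apply, Bop_apply, Fin.sum_univ_castSucc, Finset.mul_sum]
  congr 1
  · refine Finset.sum_congr rfl fun i _ => ?_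
    rw [Finset.prod_filter, Finset.prod_filter, Fin.prod_univ_castSucc]
    simp only [flipLetter, Fin.snoc_castSucc, Fin.snoc_last, Fin.castSucc_lt_castSucc_iff,
      Fin.castSucc_lt_last, if_true, Fin.snoc_update]
    ring
  · rw [Finset.prod_filter, Finset.prod_eq_one fun j _ => if_neg (Fin.le_last j).not_gt, one_mul]
    simp only [flipLetter, Fin.snoc_last, Fin.update_snoc_last]

/-- The `y`-coordinate of the eigenvector `x + c y` by which an eigenvector for `[m]` is
multiplied to obtain an eigenvector for `[m + 1]` (letter `false`) or `[m - 1]`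
(letter `true`). -/
def eigenCoeff (m : ℤ) (b : Bool) : K := if b then -q ^ (-m) else q ^ m

/-- An eigenvector of `Bop n` for `[weight w]`. -/
def eigenVec : (n : ℕ) → (Fin n → Bool) → W n
  | 0, _ => fun _ => 1
  | n + 1, w => fun u => eigenVec n (Fin.init w) (Fin.init u) *
      (if u (Fin.last n) then eigenCoeff (weight (Fin.init w)) (w (Fin.last n)) else 1)

theorem eigenVec_snoc {n : ℕ} (w u : Fin n → Bool) (b c : Bool) :
    eigenVec (n + 1) (Fin.snoc w b) (Fin.snoc u c) =
      eigenVec n w u * (if c then eigenCoeff (weight w) b else 1) := by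
  simp [eigenVec]

theorem Bop_eigenVec {n : ℕ} (w : Fin n → Bool) :
    Bop n (eigenVec n w) = qint (weight w) • eigenVec n w := by
  induction n with
  | zero =>
    funext u
    simp [Bop_apply, weight, qint]
  | succ n ih =>
    induction w using Fin.snocCases with | snoc w b
    funext u
    induction u using Fin.snocCases with | snoc u c
    have hB : Bop n (fun u' => eigenVec (n + 1) (Fin.snoc w b) (Fin.snoc u' c)) u =
        (if c then eigenCoeff (weight w) b else 1) * (qint (weight w) * eigenVec n w u) := by
      have hsmul : (fun u' => eigenVec (n + 1) (Fin.snoc w b) (Fin.snoc u' c)) =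
          (if c then eigenCoeff (weight w) b else 1) • eigenVec n w := by
        funext u'
        rw [eigenVec_snoc, Pi.smul_apply, smul_eq_mul, mul_comm]
      rw [hsmul, map_smul, ih]
      rfl
    have hq := q_ne_zero
    have hd := q_sub_inv_ne_zero
    have hm : q ^ weight w * q ^ (-weight w) = 1 := by
      rw [← zpow_add₀ hq]
      simp
    have hint : qint (weight w) * (q - q⁻¹) = q ^ weight w - q ^ (-weight w) := by
      rw [qint, div_mul_cancel₀ _ hd]
    rw [Bop_snoc, hB, Pi.smul_apply, smul_eq_mul, eigenVec_snoc, eigenVec_snoc, weight_snoc]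
    cases b <;> cases c <;>
      simp only [eigenCoeff, eps, Bool.not_true, Bool.not_false, Bool.false_eq_true, if_true,
        if_false, sub_neg_eq_add, qint_add_one, qint_sub_one, zpow_neg_one, zpow_one]
    · ring
    · linear_combination eigenVec n w u * (q ^ weight w * hint - hm)
    · ring
    · linear_combination -eigenVec n w u * (q ^ (-weight w) * hint + hm)

theorem linearIndependent_eigenVec (n : ℕ) : LinearIndependent K (eigenVec n) := by
  induction n with
  | zero =>
    rw [Fintype.linearIndependent_iff]
    intro a ha w
    have h := congrFun ha w
    rw [Finset.sum_apply, Fintype.sum_subsingleton _ w] at h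
    simpa [eigenVec] using h
  | succ n ih =>
    rw [Fintype.linearIndependent_iff] at ih ⊢
    intro a ha
    have key : ∀ (c : Bool) (w : Fin n → Bool),
        ∑ b, a (Fin.snoc w b) * (if c then eigenCoeff (weight w) b else 1) = 0 := by
      intro c
      refine ih _ ?_
      funext u
      have h := congrFun ha (Fin.snoc u c)
      rw [Finset.sum_apply, ← (Fin.snocEquiv fun _ => Bool).sum_comp, Fintype.sum_prod_type,
        Finset.sum_comm] at h
      rw [Finset.sum_apply, Pi.zero_apply]
      rw [Pi.zero_apply] at h
      rw [← h]
      refine Finset.sum_congr rfl fun w _ => ?_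
      rw [Pi.smul_apply, smul_eq_mul, Finset.sum_mul]
      refine Finset.sum_congr rfl fun b _ => ?_
      have hs : (Fin.snocEquiv fun _ : Fin (n + 1) => Bool) (b, w) = Fin.snoc w b := rfl
      rw [hs, Pi.smul_apply, smul_eq_mul, eigenVec_snoc]
      ring
    intro w
    induction w using Fin.snocCases with | snoc w b
    have h0 := key false w
    have h1 := key true w
    simp only [Fintype.sum_bool, eigenCoeff, if_true, if_false, Bool.false_eq_true] at h0 h1
    have hne := q_zpow_add_zpow_neg_ne_zero (weight w)
    cases b
    · refine (mul_eq_zero.mp ?_).resolve_right hne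
      linear_combination h1 + q ^ (-weight w) * h0
    · refine (mul_eq_zero.mp ?_).resolve_right hne
      linear_combination q ^ (weight w) * h0 - h1

/-- The basis of `W n` consisting of the eigenvectors `eigenVec n w`. -/
def eigenBasis (n : ℕ) : Module.Basis (Fin n → Bool) K (W n) :=
  basisOfLinearIndependentOfCardEqFinrank (linearIndependent_eigenVec n)
    (Module.finrank_fintype_fun_eq_card K).symm

theorem Bop_eigenBasis {n : ℕ} (w : Fin n → Bool) :
    Bop n (eigenBasis n w) = qint (weight w) • eigenBasis n w := by
  simp only [eigenBasis, coe_basisOfLinearIndependentOfCardEqFinrank, Bop_eigenVec]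

/-- If an endomorphism is diagonal in the basis `b`, then each of its eigenspaces is spanned by
the basis vectors it contains. -/
theorem eigenspace_eq_span_of_basis {F M ι : Type*} [Field F] [AddCommGroup M] [Module F M]
    (b : Module.Basis ι F M) (f : Module.End F M) (d : ι → F) (h : ∀ i, f (b i) = d i • b i)
    (μ : F) : Module.End.eigenspace f μ = Submodule.span F (b '' {i | d i = μ}) := by
  have hrepr : ∀ x i, b.repr (f x) i = d i * b.repr x i := by
    intro x i
    have : (b.coord i).comp f = d i • b.coord i := by
      refine b.ext fun j => ?_
      by_cases hij : j = i
      · subst hij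
        simp [h]
      · simp [h, hij]
    simpa using LinearMap.congr_fun this x
  apply le_antisymm
  · intro x hx
    rw [Module.Basis.mem_span_image]
    intro i hi
    have hi' : b.repr x i ≠ 0 := by simpa using hi
    have h1 := hrepr x i
    rw [Module.End.mem_eigenspace_iff.mp hx, map_smul, Finsupp.smul_apply, smul_eq_mul] at h1
    exact (mul_right_cancel₀ hi' h1).symm
  · rw [Submodule.span_le]
    rintro _ ⟨i, rfl, rfl⟩
    exact Module.End.mem_eigenspace_iff.mpr (h i)

theorem eigenspace_Bop (n : ℕ) (μ : K) :
    Module.End.eigenspace (Bop n) μ =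
      Submodule.span K (eigenBasis n '' {w | qint (weight w) = μ}) :=
  eigenspace_eq_span_of_basis _ _ _ Bop_eigenBasis μ

theorem qint_weight_eq_iff {n : ℕ} (w : Fin n → Bool) (k : ℕ) :
    qint (weight w) = qint ((n : ℤ) - 2 * k) ↔
      (Finset.univ.filter fun i => w i = true).card = k := by
  rw [qint_injective.eq_iff, weight_eq_sub_card]
  omega

theorem finrank_eigenspace_Bop (n k : ℕ) :
    Module.finrank K (Module.End.eigenspace (Bop n) (qint ((n : ℤ) - 2 * k))) =
      n.choose k := by
  classical
  have hli : LinearIndependent K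
      fun w : {w : Fin n → Bool | qint (weight w) = qint ((n : ℤ) - 2 * k)} => eigenBasis n w :=
    (eigenBasis n).linearIndependent.comp _ Subtype.val_injective
  rw [eigenspace_Bop, Set.image_eq_range, finrank_span_eq_card hli,
    ← card_words_with_card_true n k, ← Set.toFinset_card]
  congr 1
  ext w
  simp [qint_weight_eq_iff]

theorem eigenspace_Bop_ne_bot_iff (n : ℕ) (μ : K) :
    Module.End.eigenspace (Bop n) μ ≠ ⊥ ↔ ∃ k : ℕ, k ≤ n ∧ μ = qint ((n : ℤ) - 2 * k) := by
  constructor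
  · intro h
    rw [eigenspace_Bop, Ne, Submodule.span_eq_bot] at h
    push Not at h
    obtain ⟨_, ⟨w, rfl, rfl⟩, _⟩ := h
    exact ⟨_, card_finset_fin_le _, (qint_weight_eq_iff w _).mpr rfl⟩
  · rintro ⟨k, hk, rfl⟩ h
    have hr := finrank_eigenspace_Bop n k
    rw [h, finrank_bot] at hr
    exact (Nat.choose_pos hk).ne hr

/-- For `n ≥ 1`, the endomorphism `B` of `W n = V^{⊗n}` is diagonalizable
with eigenvalues exactly the quantum integers `[n-2k]`, `0 ≤ k ≤ n`: the eigenspace for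
`[n-2k]` has dimension `n choose k`, the eigenspaces span `W n`, they are independent, and
every eigenvalue of `B` is of this form. -/
theorem stmt_7 (n : ℕ) (hn : 1 ≤ n) :
    (∀ k : ℕ, k ≤ n →
      Module.finrank K (Module.End.eigenspace (Bop n) (qint ((n : ℤ) - 2 * k))) =
        n.choose k) ∧
    (⨆ k ∈ Finset.range (n + 1),
        Module.End.eigenspace (Bop n) (qint ((n : ℤ) - 2 * k)) = ⊤) ∧
    iSupIndep (fun k : Fin (n + 1) =>
      Module.End.eigenspace (Bop n) (qint ((n : ℤ) - 2 * (k : ℕ)))) ∧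
    (∀ μ : K, Module.End.HasEigenvalue (Bop n) μ ↔
      ∃ k : ℕ, k ≤ n ∧ μ = qint ((n : ℤ) - 2 * k)) := by
  refine ⟨fun k _ => finrank_eigenspace_Bop n k, ?_, ?_, eigenspace_Bop_ne_bot_iff n⟩
  · rw [Submodule.eq_top_iff_forall_basis_mem (eigenBasis n)]
    intro w
    refine Submodule.mem_iSup_of_mem (Finset.univ.filter fun i => w i = true).card
      (Submodule.mem_iSup_of_mem
        (Finset.mem_range.mpr (Nat.lt_succ_of_le (card_finset_fin_le _))) ?_)
    rw [Module.End.mem_eigenspace_iff, Bop_eigenBasis, (qint_weight_eq_iff w _).mpr rfl]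
  · refine (Module.End.eigenspaces_iSupIndep (Bop n)).comp fun a b h => ?_
    have := qint_injective h
    omega
end
end
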